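/- Fix c > 1, η_trn > 0, positive integers r and N_tst, an invertible r×r diagonal matrix Σ with positive diagonal entries, and an r×N_tst matrix L. For each N, let d = d(N) satisfy d(N)/N → c, let A_N be a d×N random matrix with i.i.d. Gaussian entries of mean 0 and variance η_trn²/d, let U_N be a d×r matrix with U_N^T U_N = I_r, let V_N be an N×r matrix with V_N^T V_N = I_r, set X_N = U_N Σ V_N^T, X_tst^{(N)} = U_N L, and W_N = X_N ((X_N + A_N)^T (X_N + A_N))^{-1} (X_N + A_N)^T. Then lim_{N→∞} E[(1/N_tst) ‖X_tst^{(N)} − W_N X_tst^{(N)}‖_F²] = (η_trn⁴/N_tst) ‖(Σ² + η_trn² I_r)^{-1} L‖_F². -/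

import Mathlib

open MeasureTheory ProbabilityTheory Matrix Filter

instance matrixMeasurableSpace {m n α : Type*} [MeasurableSpace α] :
    MeasurableSpace (Matrix m n α) :=
  inferInstanceAs (MeasurableSpace (m → n → α))

/-- The law of a `d × N` random matrix with i.i.d. real Gaussian entries of mean `0`
and variance `v`. -/
noncomputable def gaussMatrix (d N : ℕ) (v : NNReal) : Measure (Matrix (Fin d) (Fin N) ℝ) :=
  Measure.pi fun _ : Fin d => Measure.pi fun _ : Fin N => gaussianReal 0 v

/-- `W = X ((X+A)ᵀ(X+A))⁻¹ (X+A)ᵀ`, i.e. `X (X+A)†` when `X+A` has full column rank. -/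
noncomputable def Wmat {d N : ℕ} (X A : Matrix (Fin d) (Fin N) ℝ) :
    Matrix (Fin d) (Fin d) ℝ :=
  X * (((X + A)ᵀ * (X + A))⁻¹ * (X + A)ᵀ)

/-- The squared Frobenius norm `‖M‖_F² = ∑ᵢⱼ Mᵢⱼ²`. -/
def frobSq {m n : ℕ} (M : Matrix (Fin m) (Fin n) ℝ) : ℝ :=
  ∑ i, ∑ j, (M i j) ^ 2

/-- The law of a random vector with i.i.d. centred Gaussian coordinates of variance `v`. -/
noncomputable abbrev gaussVec (n : Type*) [Fintype n] (v : NNReal) : Measure (n → ℝ) :=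
  Measure.pi fun _ => gaussianReal 0 v

lemma charFunDual_gaussianReal_zero (v : NNReal) (L : StrongDual ℝ ℝ) :
    charFunDual (gaussianReal 0 v) L = Complex.exp (((-(v * (L 1) ^ 2) / 2 : ℝ)) : ℂ) := by
  have : ∀ x : ℝ, L x = L 1 * x := fun x => by
    have := L.map_smul x 1
    simp only [smul_eq_mul, mul_one] at this
    rw [this, mul_comm]
  have h2 : charFunDual (gaussianReal 0 v) L = charFun (gaussianReal 0 v) (L 1) := by
    rw [charFunDual_apply, charFun_apply_real]
    refine integral_congr_ae (Eventually.of_forall fun x => ?_)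
    beta_reduce
    rw [this x]
    push_cast
    rfl
  rw [h2, charFun_gaussianReal]
  congr 1
  push_cast
  ring

lemma charFunDual_gaussVec {n : Type*} [Fintype n] [DecidableEq n] (v : NNReal)
    (L : StrongDual ℝ (n → ℝ)) :
    charFunDual (gaussVec n v) L =
      Complex.exp (((-(v * ∑ i, (L (Pi.single i 1)) ^ 2) / 2 : ℝ)) : ℂ) := by
  rw [charFunDual_pi]
  simp_rw [charFunDual_gaussianReal_zero, ← Complex.exp_sum]
  congr 1
  push_cast
  rw [← Finset.sum_div, Finset.sum_neg_distrib, ← Finset.mul_sum]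
  rfl

lemma charFunDual_pi_gaussVec {ι n : Type*} [Fintype ι] [DecidableEq ι] [Fintype n]
    [DecidableEq n] (v : NNReal) (L : StrongDual ℝ (ι → n → ℝ)) :
    charFunDual (Measure.pi fun _ : ι => gaussVec n v) L =
      Complex.exp (((-(v * ∑ j, ∑ i, (L (Pi.single j (Pi.single i 1))) ^ 2) / 2 : ℝ)) : ℂ) := by
  rw [charFunDual_pi]
  simp_rw [charFunDual_gaussVec, ← Complex.exp_sum]
  congr 1
  push_cast
  rw [← Finset.sum_div, Finset.sum_neg_distrib, ← Finset.mul_sum]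
  rfl

lemma sum_sq_mulVec_of_transpose_mul_self {n : Type*} [Fintype n] [DecidableEq n]
    {O : Matrix n n ℝ} (hO : Oᵀ * O = 1) (x : n → ℝ) : ∑ i, (O *ᵥ x) i ^ 2 = ∑ i, x i ^ 2 := by
  have h : (O *ᵥ x) ⬝ᵥ (O *ᵥ x) = x ⬝ᵥ x := by
    rw [dotProduct_mulVec, vecMul_mulVec, hO, vecMul_one]
  simpa [dotProduct, sq] using h

lemma measurePreserving_gaussVec_mulVec {n : Type*} [Fintype n] [DecidableEq n] (v : NNReal)
    {O : Matrix n n ℝ} (hO : Oᵀ * O = 1) :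
    MeasurePreserving (fun a => O *ᵥ a) (gaussVec n v) (gaussVec n v) := by
  have hO' : Oᵀᵀ * Oᵀ = 1 := by rw [transpose_transpose]; exact mul_eq_one_comm.mp hO
  let T : (n → ℝ) →L[ℝ] (n → ℝ) := LinearMap.toContinuousLinearMap (Matrix.mulVecLin O)
  have hT : ∀ a, T a = O *ᵥ a := fun a => rfl
  refine ⟨T.continuous.measurable, ?_⟩
  have : IsProbabilityMeasure (Measure.map (fun a => T a) (gaussVec n v)) :=
    Measure.isProbabilityMeasure_map T.continuous.measurable.aemeasurable
  change Measure.map (fun a => T a) (gaussVec n v) = _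
  apply Measure.ext_of_charFunDual
  ext L
  rw [charFunDual_map, charFunDual_gaussVec, charFunDual_gaussVec]
  have key : ∀ i, (L.comp T) (Pi.single i 1) = (Oᵀ *ᵥ fun k => L (Pi.single k 1)) i := by
    intro i
    simp only [ContinuousLinearMap.comp_apply, hT, mulVec_single_one]
    have : O.col i = ∑ k, O k i • (Pi.single k (1 : ℝ) : n → ℝ) := by
      ext l; simp [Finset.sum_apply, Pi.single_apply]
    rw [this, map_sum]
    simp [mulVec, dotProduct]
  simp_rw [key, sum_sq_mulVec_of_transpose_mul_self hO']

lemma measurePreserving_columns {ι n : Type*} [Fintype ι] [DecidableEq ι] [Fintype n]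
    [DecidableEq n] (v : NNReal) {O : Matrix ι ι ℝ} (hO : Oᵀ * O = 1) :
    MeasurePreserving (fun (A : n → ι → ℝ) (j : ι) (l : n) => ∑ k, A l k * O k j)
      (Measure.pi fun _ : n => gaussVec ι v) (Measure.pi fun _ : ι => gaussVec n v) := by
  let T : (n → ι → ℝ) →L[ℝ] (ι → n → ℝ) := LinearMap.toContinuousLinearMap
    { toFun := fun A j l => ∑ k, A l k * O k j
      map_add' := fun A B => by ext; simp [add_mul, Finset.sum_add_distrib]
      map_smul' := fun c A => by ext; simp [Finset.mul_sum, mul_assoc] }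
  have hT : ∀ A, T A = fun j l => ∑ k, A l k * O k j := fun a => rfl
  refine ⟨T.continuous.measurable, ?_⟩
  have : IsProbabilityMeasure (Measure.map (fun a => T a) (Measure.pi fun _ : n => gaussVec ι v)) :=
    Measure.isProbabilityMeasure_map T.continuous.measurable.aemeasurable
  change Measure.map (fun a => T a) _ = _
  apply Measure.ext_of_charFunDual
  ext L
  rw [charFunDual_map, charFunDual_pi_gaussVec, charFunDual_pi_gaussVec]
  have key : ∀ l k, (L.comp T) (Pi.single l (Pi.single k 1)) =
      (O *ᵥ fun j => L (Pi.single j (Pi.single l 1))) k := by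
    intro l k
    simp only [ContinuousLinearMap.comp_apply]
    have : T (Pi.single l (Pi.single k 1)) =
        ∑ j, O k j • (Pi.single j (Pi.single l (1 : ℝ)) : ι → n → ℝ) := by
      rw [hT]
      ext j' l'
      by_cases h : l' = l
      · subst h
        simp only [Finset.sum_apply, Pi.smul_apply, Pi.single_apply, apply_ite (fun f : n → ℝ => f l')]
        simp [Pi.single_apply]
      · simp only [Finset.sum_apply, Pi.smul_apply, Pi.single_apply, h]
        simp only [if_false, Pi.zero_apply, zero_mul, Finset.sum_const_zero, smul_eq_mul]
        symm; apply Finset.sum_eq_zero; intro x _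
        split_ifs <;> simp [h]
    rw [this, map_sum]
    simp [mulVec, dotProduct]
  simp_rw [key, sum_sq_mulVec_of_transpose_mul_self hO]
  rw [Finset.sum_comm]

lemma exists_diagonalization {n : Type*} [Fintype n] [DecidableEq n] {M : Matrix n n ℝ}
    (hM : Mᵀ = M) : ∃ (O : Matrix n n ℝ) (w : n → ℝ), Oᵀ * O = 1 ∧ M = O * diagonal w * Oᵀ := by
  have hM' : M.IsHermitian := by rw [IsHermitian, conjTranspose_eq_transpose_of_trivial, hM]
  refine ⟨hM'.eigenvectorUnitary, hM'.eigenvalues, ?_, ?_⟩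
  · have := (Matrix.mem_unitaryGroup_iff').1 hM'.eigenvectorUnitary.2
    rwa [star_eq_conjTranspose, conjTranspose_eq_transpose_of_trivial] at this
  · have := hM'.spectral_theorem
    rw [Unitary.conjStarAlgAut_apply] at this
    rw [← conjTranspose_eq_transpose_of_trivial, ← star_eq_conjTranspose]
    simpa using this

lemma gaussianReal_zero_eq_map (v : NNReal) :
    gaussianReal 0 v = (gaussianReal 0 1).map (fun x => √(v : ℝ) * x) := by
  rw [gaussianReal_map_const_mul]
  congr 1
  · simp
  · ext; simp

/-- The variance of the square of a standard Gaussian variable. -/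
noncomputable def gaussSqVar : ℝ := Var[fun x => x ^ 2; gaussianReal 0 1]

lemma gaussSqVar_nonneg : 0 ≤ gaussSqVar := variance_nonneg _ _

lemma memLp_sq_gaussianReal (v : NNReal) : MemLp (fun x : ℝ => x ^ 2) 2 (gaussianReal 0 v) := by
  have h : MemLp (fun x : ℝ => x) 4 (gaussianReal 0 v) := memLp_id_gaussianReal' 4 (by simp)
  have h2 : MemLp (fun x : ℝ => x * x) 2 (gaussianReal 0 v) := by
    have : ENNReal.HolderTriple 4 4 2 := ⟨by
      rw [← two_mul, show (4 : ENNReal) = 2 * 2 by norm_num, ENNReal.mul_inv (by simp) (by simp),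
        ← mul_assoc, ENNReal.mul_inv_cancel (by simp) (by simp), one_mul]⟩
    exact MemLp.mul (p := 4) (q := 4) h h
  simpa [sq] using h2

lemma variance_sq_gaussianReal (v : NNReal) :
    Var[fun x => x ^ 2; gaussianReal 0 v] = gaussSqVar * v ^ 2 := by
  rw [gaussianReal_zero_eq_map, variance_map (by fun_prop) (by fun_prop)]
  have : ((fun x : ℝ => x ^ 2) ∘ fun x => √(v : ℝ) * x) = fun x => (v : ℝ) * x ^ 2 := by
    ext x; simp [mul_pow, Real.sq_sqrt]
  rw [this, variance_const_mul, gaussSqVar, mul_comm]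

lemma integral_sq_gaussianReal (v : NNReal) : ∫ x, x ^ 2 ∂(gaussianReal 0 v) = v := by
  have h := variance_eq_sub (memLp_id_gaussianReal (μ := 0) (v := v) 2)
  rw [variance_id_gaussianReal] at h
  simp only [id, integral_id_gaussianReal, Pi.pow_apply] at h
  simpa using h.symm

section Quadratic

variable {n : Type*} [Fintype n] [DecidableEq n]

lemma dotProduct_conj_mulVec (O : Matrix n n ℝ) (w a : n → ℝ) :
    a ⬝ᵥ ((O * diagonal w * Oᵀ) *ᵥ a) = ∑ l, w l * (Oᵀ *ᵥ a) l ^ 2 := by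
  rw [← mulVec_mulVec, ← mulVec_mulVec, dotProduct_mulVec, ← mulVec_transpose]
  simp only [dotProduct, mulVec_diagonal]
  refine Finset.sum_congr rfl fun i _ => by ring

lemma trace_conj {O : Matrix n n ℝ} (hO : Oᵀ * O = 1) (D : Matrix n n ℝ) :
    (O * D * Oᵀ).trace = D.trace := by
  rw [trace_mul_comm, ← mul_assoc, hO, one_mul]

lemma transpose_orthogonal {O : Matrix n n ℝ} (hO : Oᵀ * O = 1) : Oᵀᵀ * Oᵀ = 1 := by
  rw [transpose_transpose]; exact mul_eq_one_comm.mp hO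

lemma quadraticForm_gaussVec (v : NNReal) {M : Matrix n n ℝ} (hM : Mᵀ = M) :
    MemLp (fun a => a ⬝ᵥ (M *ᵥ a)) 2 (gaussVec n v) ∧
    ∫ a, a ⬝ᵥ (M *ᵥ a) ∂(gaussVec n v) = v * M.trace ∧
    Var[fun a => a ⬝ᵥ (M *ᵥ a); gaussVec n v] = gaussSqVar * v ^ 2 * (M * M).trace := by
  obtain ⟨O, w, hO, rfl⟩ := exists_diagonalization hM
  have hmp := measurePreserving_gaussVec_mulVec v (transpose_orthogonal hO)
  set f : (n → ℝ) → ℝ := fun b => ∑ l, w l * b l ^ 2 with hf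
  have hfm : Measurable f := by fun_prop
  have hcomp : (fun a => a ⬝ᵥ ((O * diagonal w * Oᵀ) *ᵥ a)) = f ∘ fun a => Oᵀ *ᵥ a := by
    ext a; exact dotProduct_conj_mulVec O w a
  have hev : ∀ l : n, MeasurePreserving (Function.eval l) (gaussVec n v) (gaussianReal 0 v) :=
    fun l => measurePreserving_eval _ l
  have hmem : ∀ l : n, MemLp (fun b : n → ℝ => w l * b l ^ 2) 2 (gaussVec n v) := fun l =>
    ((memLp_sq_gaussianReal v).comp_measurePreserving (hev l)).const_mul (w l)
  have hfL : MemLp f 2 (gaussVec n v) := memLp_finsetSum _ fun l _ => hmem l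
  rw [hcomp]
  refine ⟨hfL.comp_measurePreserving hmp, ?_, ?_⟩
  · have h1 : ∫ a, (f ∘ fun a => Oᵀ *ᵥ a) a ∂(gaussVec n v) = ∫ b, f b ∂(gaussVec n v) := by
      conv_rhs => rw [← hmp.map_eq]
      rw [integral_map hmp.measurable.aemeasurable hfm.aestronglyMeasurable]
      rfl
    refine h1.trans ?_
    rw [integral_finsetSum _ fun l _ => (hmem l).integrable (by norm_num)]
    rw [trace_conj hO, trace_diagonal, Finset.mul_sum]
    refine Finset.sum_congr rfl fun l _ => ?_
    rw [integral_const_mul]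
    have h3 : ∫ b : n → ℝ, b l ^ 2 ∂(gaussVec n v) = ∫ x, x ^ 2 ∂(gaussianReal 0 v) := by
      rw [← (hev l).map_eq, integral_map (hev l).measurable.aemeasurable
        (by fun_prop : AEStronglyMeasurable _ _)]
    rw [h3, integral_sq_gaussianReal, mul_comm]
  · have h1 : Var[f ∘ fun a => Oᵀ *ᵥ a; gaussVec n v] = Var[f; gaussVec n v] := by
      conv_rhs => rw [← hmp.map_eq]
      rw [variance_map hfm.aemeasurable hmp.measurable.aemeasurable]
    have hind : iIndepFun (fun (l : n) (b : n → ℝ) => w l * b l ^ 2) (gaussVec n v) :=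
      iIndepFun_pi (X := fun l x => w l * x ^ 2) fun l => by fun_prop
    have h2 : f = ∑ l, fun b : n → ℝ => w l * b l ^ 2 := by
      ext b; simp [hf]
    rw [h1, h2, IndepFun.variance_sum (fun l _ => hmem l)
      fun i _ j _ hij => hind.indepFun hij]
    have h3 : (O * diagonal w * Oᵀ) * (O * diagonal w * Oᵀ) = O * diagonal (fun l => w l ^ 2) * Oᵀ := by
      have : (O * diagonal w * Oᵀ) * (O * diagonal w * Oᵀ) =
          O * (diagonal w * (Oᵀ * O) * diagonal w) * Oᵀ := by simp only [mul_assoc]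
      rw [this, hO, mul_one, diagonal_mul_diagonal]
      simp [sq]
    rw [h3, trace_conj hO, trace_diagonal, Finset.mul_sum]
    refine Finset.sum_congr rfl fun l _ => ?_
    rw [variance_const_mul]
    have h4 : Var[fun b : n → ℝ => b l ^ 2; gaussVec n v] = Var[fun x => x ^ 2; gaussianReal 0 v] := by
      rw [← (hev l).map_eq, variance_map (by fun_prop) (hev l).measurable.aemeasurable]
      rfl
    rw [h4, variance_sq_gaussianReal]
    ring

lemma lintegral_sub_sq_eq {Ω : Type*} [MeasurableSpace Ω] {P : Measure Ω} [IsProbabilityMeasure P]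
    {f : Ω → ℝ} (hf : MemLp f 2 P) (s : ℝ) :
    ∫⁻ x, ENNReal.ofReal ((f x - s) ^ 2) ∂P =
      ENNReal.ofReal (Var[f; P] + (∫ x, f x ∂P - s) ^ 2) := by
  have hfs : MemLp (fun x => f x - s) 2 P := hf.sub (memLp_const s)
  rw [← ofReal_integral_eq_lintegral_ofReal hfs.integrable_sq
    (Eventually.of_forall fun x => sq_nonneg _)]
  congr 1
  have h1 := variance_eq_sub hfs
  have h2 : Var[fun x => f x - s; P] = Var[f; P] := variance_sub_const hf.1 s
  rw [h2, integral_sub (hf.integrable (by norm_num)) (integrable_const s)] at h1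
  simp only [integral_const, Pi.pow_apply, probReal_univ, one_smul] at h1
  linarith

lemma lintegral_quadraticForm_sub_sq (v : NNReal) {M : Matrix n n ℝ} (hM : Mᵀ = M) (s : ℝ) :
    ∫⁻ a, ENNReal.ofReal ((a ⬝ᵥ (M *ᵥ a) - s) ^ 2) ∂(gaussVec n v) =
      ENNReal.ofReal (gaussSqVar * v ^ 2 * (M * M).trace + (v * M.trace - s) ^ 2) := by
  obtain ⟨h1, h2, h3⟩ := quadraticForm_gaussVec v hM
  rw [lintegral_sub_sq_eq h1, h2, h3]

lemma lintegral_dotProduct_sq (v : NNReal) (x : n → ℝ) :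
    ∫⁻ a, ENNReal.ofReal ((a ⬝ᵥ x) ^ 2) ∂(gaussVec n v) = ENNReal.ofReal (v * (x ⬝ᵥ x)) := by
  obtain ⟨h1, h2, -⟩ := quadraticForm_gaussVec v (M := vecMulVec x x) (transpose_vecMulVec x x)
  have h : ∀ a : n → ℝ, a ⬝ᵥ (vecMulVec x x *ᵥ a) = (a ⬝ᵥ x) ^ 2 := fun a => by
    rw [vecMulVec_mulVec]
    simp [sq, dotProduct_comm x a]
  simp only [h] at h1 h2
  rw [← ofReal_integral_eq_lintegral_ofReal (h1.integrable (by norm_num))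
    (Eventually.of_forall fun x => sq_nonneg _), h2, trace_vecMulVec]

end Quadratic

lemma exists_lintegral_rpow_gaussianReal_one_le :
    ∃ C : ℝ, 0 ≤ C ∧ ∀ m : ℝ,
      ∫⁻ y, ENNReal.ofReal (|m + y| ^ (-(1 / 2) : ℝ)) ∂(gaussianReal 0 1) ≤ ENNReal.ofReal C := by
  have hint : IntegrableOn (fun x : ℝ => |x| ^ (-(1 / 2) : ℝ)) (Set.Icc (-1) 1) := by
    have h1 : IntervalIntegrable (fun x : ℝ => |x| ^ (-(1 / 2) : ℝ)) volume 0 1 := by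
      refine (intervalIntegral.intervalIntegrable_rpow' (r := -(1 / 2)) (by norm_num)).congr ?_
      intro x hx
      rw [Set.uIoc_of_le zero_le_one] at hx
      simp [abs_of_pos hx.1]
    have h2 : IntervalIntegrable (fun x : ℝ => |x| ^ (-(1 / 2) : ℝ)) volume (-1) 0 := by
      have := ((IntervalIntegrable.iff_comp_neg (by simp)).mp h1).symm
      simpa using this
    have h3 := h2.trans h1
    rw [intervalIntegrable_iff_integrableOn_Icc_of_le (by norm_num)] at h3
    exact h3
  have hmeas : Measurable (fun x : ℝ => ENNReal.ofReal (|x| ^ (-(1 / 2) : ℝ))) := by fun_prop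
  set I := ∫⁻ x in Set.Icc (-1 : ℝ) 1, ENNReal.ofReal (|x| ^ (-(1 / 2) : ℝ)) with hI
  have hIfin : I ≠ ⊤ := by
    have := hint.lintegral_lt_top
    exact this.ne
  refine ⟨1 + I.toReal, by positivity, fun m => ?_⟩
  rw [ENNReal.ofReal_add zero_le_one ENNReal.toReal_nonneg, ENNReal.ofReal_toReal hIfin,
    ENNReal.ofReal_one]
  have hpdf : ∀ x, gaussianPDF 0 1 x ≤ 1 := by
    intro x
    rw [gaussianPDF, ← ENNReal.ofReal_one]
    apply ENNReal.ofReal_le_ofReal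
    rw [gaussianPDFReal]
    have h1 : (√(2 * Real.pi * ((1 : NNReal) : ℝ)))⁻¹ ≤ 1 := by
      apply inv_le_one_of_one_le₀
      rw [Real.one_le_sqrt]
      have := Real.pi_gt_three
      push_cast; linarith
    have h2 : Real.exp (-(x - 0) ^ 2 / (2 * ((1 : NNReal) : ℝ))) ≤ 1 := by
      rw [Real.exp_le_one_iff]
      have := sq_nonneg (x - 0)
      push_cast; linarith
    exact mul_le_one₀ h1 (Real.exp_nonneg _) h2
  have hle : gaussianReal 0 1 ≤ (volume : Measure ℝ) := by
    rw [gaussianReal_of_var_ne_zero 0 one_ne_zero]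
    conv_rhs => rw [← withDensity_one (μ := (volume : Measure ℝ))]
    exact withDensity_mono (Eventually.of_forall hpdf)
  calc ∫⁻ y, ENNReal.ofReal (|m + y| ^ (-(1 / 2) : ℝ)) ∂(gaussianReal 0 1)
      ≤ ∫⁻ y, (1 + (Set.Icc (-1 : ℝ) 1).indicator
          (fun x => ENNReal.ofReal (|x| ^ (-(1 / 2) : ℝ))) (m + y)) ∂(gaussianReal 0 1) := by
        refine lintegral_mono fun y => ?_
        by_cases h : m + y ∈ Set.Icc (-1 : ℝ) 1
        · rw [Set.indicator_of_mem h]; exact le_add_self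
        · rw [Set.indicator_of_notMem h, add_zero]
          have h1 : 1 ≤ |m + y| := by
            by_contra hlt
            push Not at hlt
            exact h (abs_le.mp hlt.le)
          rw [← ENNReal.ofReal_one]
          exact ENNReal.ofReal_le_ofReal (Real.rpow_le_one_of_one_le_of_nonpos h1 (by norm_num))
    _ = 1 + ∫⁻ y, (Set.Icc (-1 : ℝ) 1).indicator
          (fun x => ENNReal.ofReal (|x| ^ (-(1 / 2) : ℝ))) (m + y) ∂(gaussianReal 0 1) := by
        rw [lintegral_add_left measurable_const]; simp
    _ ≤ 1 + ∫⁻ y, (Set.Icc (-1 : ℝ) 1).indicator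
          (fun x => ENNReal.ofReal (|x| ^ (-(1 / 2) : ℝ))) (m + y) := by
        gcongr
    _ = 1 + I := by
        rw [lintegral_add_left_eq_self (μ := (volume : Measure ℝ)) (fun z => (Set.Icc (-1 : ℝ) 1).indicator
          (fun x => ENNReal.ofReal (|x| ^ (-(1 / 2) : ℝ))) z) m, lintegral_indicator measurableSet_Icc]

/-- A bound, uniform in `m`, for the moment of order `-1/2` of a Gaussian variable with mean `m`
and unit variance. -/
noncomputable def negMomentBound : ℝ := exists_lintegral_rpow_gaussianReal_one_le.choose

lemma negMomentBound_nonneg : 0 ≤ negMomentBound :=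
  exists_lintegral_rpow_gaussianReal_one_le.choose_spec.1

lemma lintegral_rpow_gaussianReal_le {v : NNReal} (hv : v ≠ 0) (m : ℝ) :
    ∫⁻ y, ENNReal.ofReal (|m + y| ^ (-(1 / 2) : ℝ)) ∂(gaussianReal 0 v) ≤
      ENNReal.ofReal ((v : ℝ) ^ (-(1 / 4) : ℝ) * negMomentBound) := by
  have hv0 : (0 : ℝ) < v := by positivity
  have hs : 0 < √(v : ℝ) := Real.sqrt_pos.2 hv0
  rw [gaussianReal_zero_eq_map, lintegral_map (by fun_prop) (by fun_prop)]
  have h : ∀ y : ℝ, ENNReal.ofReal (|m + √(v : ℝ) * y| ^ (-(1 / 2) : ℝ)) =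
      ENNReal.ofReal ((v : ℝ) ^ (-(1 / 4) : ℝ)) *
        ENNReal.ofReal (|m / √(v : ℝ) + y| ^ (-(1 / 2) : ℝ)) := by
    intro y
    rw [← ENNReal.ofReal_mul (by positivity)]
    congr 1
    have : m + √(v : ℝ) * y = √(v : ℝ) * (m / √(v : ℝ) + y) := by field_simp
    rw [this, abs_mul, abs_of_pos hs, Real.mul_rpow hs.le (abs_nonneg _), Real.sqrt_eq_rpow,
      ← Real.rpow_mul hv0.le]
    norm_num
  simp_rw [h]
  rw [lintegral_const_mul _ (by fun_prop), ENNReal.ofReal_mul (by positivity)]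
  gcongr
  exact exists_lintegral_rpow_gaussianReal_one_le.choose_spec.2 _

lemma lintegral_rpow_le_rpow_lintegral {Ω : Type*} [MeasurableSpace Ω] {P : Measure Ω}
    [IsProbabilityMeasure P] {f : Ω → ENNReal} (hf : AEMeasurable f P) {p : ℝ} (hp : 0 < p)
    (hp1 : p ≤ 1) : ∫⁻ x, f x ^ p ∂P ≤ (∫⁻ x, f x ∂P) ^ p := by
  rcases hp1.eq_or_lt with rfl | hlt
  · simp
  have h := ENNReal.lintegral_mul_le_Lp_mul_Lq P (p := 1 / p) (q := (1 - p)⁻¹)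
    ⟨by simp, by positivity, by rw [inv_pos]; linarith⟩ (hf.pow_const p)
    (aemeasurable_const (b := (1 : ENNReal)))
  simp only [Pi.mul_apply, mul_one, ENNReal.one_rpow, lintegral_const, measure_univ] at h
  simpa [← ENNReal.rpow_mul, hp.ne'] using h

lemma sum_sq_inv_sq_le {n : Type*} (s : Finset n) (hs : 0 < s.card) (x : n → ℝ)
    (hx : ∀ l, x l ≠ 0) :
    ((∑ l ∈ s, x l ^ 2)⁻¹) ^ 2 ≤
      ((s.card : ℝ)⁻¹) ^ 2 * ∏ l ∈ s, (|x l| ^ (-(1 / 2) : ℝ)) ^ (8 / s.card : ℝ) := by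
  have hk : (0 : ℝ) < s.card := by exact_mod_cast hs
  have hag := Real.geom_mean_le_arith_mean_weighted s (fun _ => (s.card : ℝ)⁻¹) (fun l => x l ^ 2)
    (fun _ _ => by positivity) (by simp [hk.ne']) (fun _ _ => by positivity)
  rw [← Finset.mul_sum] at hag
  have hpos : 0 < ∏ l ∈ s, (x l ^ 2) ^ ((s.card : ℝ)⁻¹) := by
    apply Finset.prod_pos; intro l _
    have := hx l
    positivity
  have hrw : ∏ l ∈ s, (|x l| ^ (-(1 / 2) : ℝ)) ^ (8 / s.card : ℝ) =
      ((∏ l ∈ s, (x l ^ 2) ^ ((s.card : ℝ)⁻¹)) ^ 2)⁻¹ := by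
    rw [← Finset.prod_pow, ← Finset.prod_inv_distrib]
    refine Finset.prod_congr rfl fun l _ => ?_
    have h0 : 0 < |x l| := abs_pos.2 (hx l)
    rw [← sq_abs (x l), ← Real.rpow_mul h0.le, ← Real.rpow_natCast, ← Real.rpow_natCast,
      ← Real.rpow_mul h0.le, ← Real.rpow_mul h0.le, ← Real.rpow_neg h0.le]
    congr 1
    push_cast
    field_simp
    norm_num
  rw [hrw, ← inv_pow, ← mul_pow, ← mul_inv]
  gcongr
  calc _ ≤ (s.card : ℝ) * ((s.card : ℝ)⁻¹ * ∑ l ∈ s, x l ^ 2) := by gcongr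
    _ = _ := by field_simp

lemma lintegral_sum_sq_inv_sq_le {n : Type*} [Fintype n] {v : NNReal} (hv : v ≠ 0)
    (s : Finset n) (hs : 8 ≤ s.card) (m : n → ℝ) :
    ∫⁻ b, ENNReal.ofReal (((∑ l ∈ s, (m l + b l) ^ 2)⁻¹) ^ 2) ∂(gaussVec n v) ≤
      ENNReal.ofReal (negMomentBound ^ 8 / (v * s.card) ^ 2) := by
  have hk : (0 : ℝ) < s.card := by exact_mod_cast (by omega : 0 < s.card)
  have hk8 : (8 : ℝ) ≤ s.card := by exact_mod_cast hs
  have hv0 : (0 : ℝ) < v := by positivity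
  have hc0 := negMomentBound_nonneg
  have := nullSingletonClass_gaussianReal (μ := 0) hv
  have hae : ∀ᵐ b ∂(gaussVec n v), ∀ l, m l + b l ≠ 0 := by
    rw [ae_all_iff]
    intro l
    filter_upwards [Measure.ae_eval_ne (μ := fun _ : n => gaussianReal 0 v) l (-m l)] with b hb h
    exact hb (by linarith)
  set p : ℝ := 8 / s.card with hp
  set J : ENNReal := ENNReal.ofReal ((v : ℝ) ^ (-(1 / 4) : ℝ) * negMomentBound) with hJ
  calc _ ≤ ∫⁻ b, ENNReal.ofReal (((s.card : ℝ)⁻¹) ^ 2) *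
        ∏ l ∈ s, ENNReal.ofReal (|m l + b l| ^ (-(1 / 2) : ℝ)) ^ p ∂(gaussVec n v) := by
        refine lintegral_mono_ae ?_
        filter_upwards [hae] with b hb
        have h := sum_sq_inv_sq_le s (by omega) (fun l => m l + b l) hb
        refine (ENNReal.ofReal_le_ofReal h).trans_eq ?_
        rw [ENNReal.ofReal_mul (by positivity), ENNReal.ofReal_prod_of_nonneg
          (fun _ _ => by positivity)]
        congr 1
        refine Finset.prod_congr rfl fun l _ => ?_
        rw [ENNReal.ofReal_rpow_of_nonneg (by positivity) (by positivity)]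
    _ = ENNReal.ofReal (((s.card : ℝ)⁻¹) ^ 2) *
        ∏ l ∈ s, ∫⁻ y, ENNReal.ofReal (|m l + y| ^ (-(1 / 2) : ℝ)) ^ p ∂(gaussianReal 0 v) := by
        rw [lintegral_const_mul _ (by fun_prop)]
        congr 1
        have hind : iIndepFun (fun (l : n) (b : n → ℝ) =>
            ENNReal.ofReal (|m l + b l| ^ (-(1 / 2) : ℝ)) ^ p) (gaussVec n v) :=
          iIndepFun_pi (X := fun l y => ENNReal.ofReal (|m l + y| ^ (-(1 / 2) : ℝ)) ^ p)
            fun l => by fun_prop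
        rw [lintegral_prod_eq_prod_lintegral_of_indepFun s _ hind fun l => by fun_prop]
        refine Finset.prod_congr rfl fun l _ => ?_
        rw [← (measurePreserving_eval (fun _ : n => gaussianReal 0 v) l).map_eq,
          lintegral_map (by fun_prop) (by fun_prop)]
    _ ≤ ENNReal.ofReal (((s.card : ℝ)⁻¹) ^ 2) * ∏ l ∈ s, J ^ p := by
        gcongr with l _
        refine (lintegral_rpow_le_rpow_lintegral (by fun_prop) (by positivity)
          (by rw [hp, div_le_one hk]; exact hk8)).trans ?_
        exact ENNReal.rpow_le_rpow (lintegral_rpow_gaussianReal_le hv (m l)) (by positivity)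
    _ = ENNReal.ofReal (negMomentBound ^ 8 / (v * s.card) ^ 2) := by
        rw [Finset.prod_const, ← ENNReal.rpow_natCast, ← ENNReal.rpow_mul]
        have : p * (s.card : ℝ) = (8 : ℕ) := by rw [hp]; field_simp; norm_num
        rw [this, ENNReal.rpow_natCast, hJ, ← ENNReal.ofReal_pow (by positivity),
          ← ENNReal.ofReal_mul (by positivity)]
        congr 1
        rw [mul_pow, ← Real.rpow_natCast ((v : ℝ) ^ _), ← Real.rpow_mul hv0.le]
        have : (-(1 / 4) * ((8 : ℕ) : ℝ)) = -((2 : ℕ) : ℝ) := by norm_num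
        rw [this, Real.rpow_neg hv0.le, Real.rpow_natCast]
        field_simp

lemma lintegral_projection_inv_sq_le {n : Type*} [Fintype n] [DecidableEq n] {v : NNReal}
    (hv : v ≠ 0) {Q : Matrix n n ℝ} (hQ : Qᵀ = Q) (hQQ : Q * Q = Q) (h8 : 8 ≤ Q.trace)
    (m : n → ℝ) :
    ∫⁻ a, ENNReal.ofReal ((((m + a) ⬝ᵥ (Q *ᵥ (m + a)))⁻¹) ^ 2) ∂(gaussVec n v) ≤
      ENNReal.ofReal (negMomentBound ^ 8 / (v * Q.trace) ^ 2) := by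
  obtain ⟨O, w, hO, rfl⟩ := exists_diagonalization hQ
  have hw : ∀ l, w l = 0 ∨ w l = 1 := by
    have h1 : (O * diagonal w * Oᵀ) * (O * diagonal w * Oᵀ) =
        O * (diagonal w * (Oᵀ * O) * diagonal w) * Oᵀ := by simp only [mul_assoc]
    rw [h1, hO, mul_one] at hQQ
    have h2 := congrArg (fun X => Oᵀ * X * O) hQQ
    have h3 : ∀ X, Oᵀ * (O * X * Oᵀ) * O = X := fun X => by
      calc Oᵀ * (O * X * Oᵀ) * O = (Oᵀ * O) * X * (Oᵀ * O) := by simp only [mul_assoc]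
        _ = X := by rw [hO, one_mul, mul_one]
    simp only [h3, diagonal_mul_diagonal] at h2
    intro l
    have := congrFun (diagonal_injective h2) l
    rcases mul_eq_zero.mp (by linear_combination this : w l * (w l - 1) = 0) with h | h
    · exact Or.inl h
    · exact Or.inr (by linarith)
  classical
  set s : Finset n := Finset.univ.filter fun l => w l = 1 with hs
  have hsum : ∀ g : n → ℝ, ∑ l, w l * g l = ∑ l ∈ s, g l := by
    intro g
    rw [hs, Finset.sum_filter]
    refine Finset.sum_congr rfl fun l _ => ?_
    rcases hw l with h | h <;> simp [h]
  have htr : (O * diagonal w * Oᵀ).trace = s.card := by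
    rw [trace_conj hO, trace_diagonal]
    have := hsum fun _ => 1
    simpa using this
  rw [htr] at h8 ⊢
  have hmp := measurePreserving_gaussVec_mulVec v (transpose_orthogonal hO)
  have hcongr : ∀ a, ENNReal.ofReal ((((m + a) ⬝ᵥ ((O * diagonal w * Oᵀ) *ᵥ (m + a)))⁻¹) ^ 2) =
      (fun b => ENNReal.ofReal (((∑ l ∈ s, ((Oᵀ *ᵥ m) l + b l) ^ 2)⁻¹) ^ 2)) (Oᵀ *ᵥ a) := by
    intro a
    rw [dotProduct_conj_mulVec, hsum, mulVec_add]
    rfl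
  simp_rw [hcongr]
  refine (hmp.lintegral_comp (f := fun b => ENNReal.ofReal (((∑ l ∈ s, ((Oᵀ *ᵥ m) l + b l) ^ 2)⁻¹) ^ 2))
    (by fun_prop)).trans_le ?_
  exact lintegral_sum_sq_inv_sq_le hv s (by exact_mod_cast h8) _

section Update

variable {ι : Type*} [Fintype ι] [DecidableEq ι] {X : ι → Type*} [∀ i, MeasurableSpace (X i)]
  (μ : ∀ i, Measure (X i)) [∀ i, IsProbabilityMeasure (μ i)]

lemma lintegral_pi_update {f : (∀ i, X i) → ENNReal} (hf : Measurable f) (i : ι) :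
    ∫⁻ x, f x ∂(Measure.pi μ) = ∫⁻ x, ∫⁻ a, f (Function.update x i a) ∂(μ i) ∂(Measure.pi μ) := by
  set g : (∀ i, X i) → ENNReal := fun x => ∫⁻ a, f (Function.update x i a) ∂(μ i) with hg
  have hgm : Measurable g := by
    have : Measurable fun p : (∀ i, X i) × X i => f (Function.update p.1 i p.2) :=
      hf.comp measurable_update'
    exact this.lintegral_prod_right'
  have h1 := lmarginal_erase' (μ := μ) (s := Finset.univ) f hf (Finset.mem_univ i)
  have h2 := lmarginal_erase' (μ := μ) (s := Finset.univ) g hgm (Finset.mem_univ i)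
  have h3 : (fun x => ∫⁻ a, g (Function.update x i a) ∂(μ i)) = g := by
    ext x; simp [hg]
  rw [h3] at h2
  rw [← hg] at h1
  rw [← h2, lmarginal_univ, lmarginal_univ] at h1
  obtain ⟨x⟩ : Nonempty (∀ i, X i) := ⟨fun i => (IsProbabilityMeasure.ne_zero (μ i) |>
    fun h => (Measure.nonempty_of_neZero (μ i)).some)⟩
  exact congrFun h1 x

lemma ae_pi_of_ae_update {p : (∀ i, X i) → Prop} (hp : MeasurableSet {x | p x}) (i : ι)
    (h : ∀ᵐ x ∂(Measure.pi μ), ∀ᵐ a ∂(μ i), p (Function.update x i a)) :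
    ∀ᵐ x ∂(Measure.pi μ), p x := by
  have hm : Measurable ({x | p x}ᶜ.indicator (1 : (∀ i, X i) → ENNReal)) :=
    measurable_one.indicator hp.compl
  have hz := lintegral_pi_update μ hm i
  rw [lintegral_indicator_one hp.compl] at hz
  rw [ae_iff]
  refine hz.trans ?_
  rw [lintegral_eq_zero_iff']
  · filter_upwards [h] with x hx
    refine (lintegral_congr_ae (g := 0) ?_).trans (by simp)
    filter_upwards [hx] with a ha
    simp [ha]
  · have : Measurable fun q : (∀ i, X i) × X i =>
      ({x | p x}ᶜ.indicator (1 : (∀ i, X i) → ENNReal)) (Function.update q.1 i q.2) :=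
      hm.comp measurable_update'
    exact this.lintegral_prod_right'.aemeasurable

end Update

section Independence

variable {ι n : Type*} [Fintype ι] [DecidableEq ι] [Fintype n] [DecidableEq n]

lemma ae_gaussVec_dotProduct_ne {v : NNReal} (hv : v ≠ 0) {w : n → ℝ} (hw : w ≠ 0) (c : ℝ) :
    ∀ᵐ a ∂(gaussVec n v), a ⬝ᵥ w ≠ c := by
  obtain ⟨l, hl⟩ := Function.ne_iff.mp hw
  have := nullSingletonClass_gaussianReal (μ := 0) hv
  have hcont : Continuous fun a : n → ℝ => a ⬝ᵥ w := by fun_prop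
  refine ae_pi_of_ae_update _ ((isClosed_eq hcont continuous_const).isOpen_compl.measurableSet) l
    (Eventually.of_forall fun x => ?_)
  have hupd : ∀ t : ℝ, Function.update x l t ⬝ᵥ w = (x ⬝ᵥ w - x l * w l) + t * w l := by
    intro t
    simp only [dotProduct]
    rw [← Finset.add_sum_erase _ _ (Finset.mem_univ l),
      ← Finset.add_sum_erase _ (fun i => x i * w i) (Finset.mem_univ l)]
    have : ∀ i ∈ Finset.univ.erase l, Function.update x l t i * w i = x i * w i := by
      intro i hi
      rw [Function.update_of_ne (Finset.ne_of_mem_erase hi)]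
    rw [Finset.sum_congr rfl this]
    simp
    ring
  have hne := Measure.ae_ne (gaussianReal 0 v) ((c - (x ⬝ᵥ w - x l * w l)) / w l)
  filter_upwards [hne] with t ht h
  rw [hupd] at h
  apply ht
  rw [eq_div_iff hl]
  linarith

lemma ae_gaussVec_notMem_submodule {v : NNReal} (hv : v ≠ 0) {p : Submodule ℝ (n → ℝ)} (hp : p ≠ ⊤)
    (m : n → ℝ) : ∀ᵐ a ∂(gaussVec n v), m + a ∉ p := by
  obtain ⟨f, hf0, hf⟩ := Submodule.exists_le_ker_of_lt_top p (lt_top_iff_ne_top.mpr hp)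
  set w : n → ℝ := fun i => f (Pi.single i 1) with hw
  have hfw : ∀ a, f a = a ⬝ᵥ w := by
    intro a
    conv_lhs => rw [pi_eq_sum_univ' a]
    simp [dotProduct, hw]
  have hw0 : w ≠ 0 := by
    rintro h0
    apply hf0
    ext a
    simp
    exact congrFun h0 a
  filter_upwards [ae_gaussVec_dotProduct_ne hv hw0 (-(m ⬝ᵥ w))] with a ha hmem
  have := hf hmem
  rw [LinearMap.mem_ker, hfw, add_dotProduct] at this
  apply ha
  linarith

lemma ae_linearIndependent {v : NNReal} (hv : v ≠ 0) (hcard : Fintype.card ι ≤ Fintype.card n)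
    (m : ι → n → ℝ) :
    ∀ᵐ A ∂(Measure.pi fun _ : ι => gaussVec n v), LinearIndependent ℝ (m + A) := by
  suffices h : ∀ s : Finset ι, ∀ᵐ A ∂(Measure.pi fun _ : ι => gaussVec n v),
      LinearIndepOn ℝ (m + A) (s : Set ι) by
    filter_upwards [h Finset.univ] with A hA
    rwa [Finset.coe_univ, linearIndepOn_univ_iff] at hA
  intro s
  induction s using Finset.induction_on with
  | empty => simp
  | insert i s hi ih =>
    have hmeas : MeasurableSet {A : ι → n → ℝ |
        LinearIndepOn ℝ (m + A) ((insert i s : Finset ι) : Set ι)} := by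
      have ho : IsOpen {f : ((insert i s : Finset ι) : Set ι) → n → ℝ | LinearIndependent ℝ f} :=
        isOpen_setOfPred_linearIndependent
      have hc : Continuous fun (A : ι → n → ℝ) (j : ((insert i s : Finset ι) : Set ι)) =>
        (m + A) j := by fun_prop
      exact (ho.preimage hc).measurableSet
    refine ae_pi_of_ae_update _ hmeas i ?_
    filter_upwards [ih] with A hA
    have hspan : Submodule.span ℝ ((m + A) '' (s : Set ι)) ≠ ⊤ := by
      intro htop
      have h1 : Module.finrank ℝ (Submodule.span ℝ ((m + A) '' (s : Set ι))) ≤ s.card := by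
        classical
        rw [← Finset.coe_image]
        exact (finrank_span_finset_le_card _).trans Finset.card_image_le
      rw [htop, finrank_top, Module.finrank_fintype_fun_eq_card] at h1
      have h2 : s.card < Fintype.card ι :=
        Finset.card_lt_univ_of_notMem hi
      omega
    filter_upwards [ae_gaussVec_notMem_submodule hv hspan (m i)] with a ha
    rw [Finset.coe_insert, linearIndepOn_insert (by simpa using hi)]
    have hcongr : ∀ j ∈ (s : Set ι), (m + Function.update A i a) j = (m + A) j := by
      intro j hj
      have : j ≠ i := by rintro rfl; exact hi (by simpa using hj)
      simp [Function.update_of_ne this]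
    refine ⟨hA.congr fun j hj => (hcongr j hj).symm, ?_⟩
    rw [Set.image_congr hcongr]
    simpa using ha

end Independence

section ResProj

variable {n κ : Type*} [Fintype n] [DecidableEq n] [Fintype κ] [DecidableEq κ]

/-- The orthogonal projection onto the orthogonal complement of the column space of `B`
(when `Bᵀ * B` is invertible). -/
noncomputable def resProj (B : Matrix n κ ℝ) : Matrix n n ℝ := 1 - B * ((Bᵀ * B)⁻¹ * Bᵀ)

lemma transpose_gram_inv (B : Matrix n κ ℝ) : ((Bᵀ * B)⁻¹)ᵀ = (Bᵀ * B)⁻¹ := by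
  rw [transpose_nonsing_inv, transpose_mul, transpose_transpose]

lemma transpose_resProj (B : Matrix n κ ℝ) : (resProj B)ᵀ = resProj B := by
  rw [resProj, transpose_sub, transpose_mul, transpose_mul, transpose_gram_inv,
    transpose_transpose, transpose_one, Matrix.mul_assoc]

lemma resProj_mul (B : Matrix n κ ℝ) (hB : IsUnit (Bᵀ * B).det) : resProj B * B = 0 := by
  rw [resProj, Matrix.sub_mul, Matrix.one_mul, Matrix.mul_assoc, Matrix.mul_assoc,
    nonsing_inv_mul _ hB, Matrix.mul_one, sub_self]

lemma resProj_mul_self (B : Matrix n κ ℝ) : resProj B * resProj B = resProj B := by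
  by_cases hB : IsUnit (Bᵀ * B).det
  · conv_lhs => rw [resProj.eq_def B, mul_sub, mul_one, ← resProj.eq_def, ← Matrix.mul_assoc,
      resProj_mul B hB, Matrix.zero_mul, sub_zero]
  · rw [resProj, nonsing_inv_apply_not_isUnit _ hB]
    simp

lemma trace_resProj (B : Matrix n κ ℝ) (hB : IsUnit (Bᵀ * B).det) :
    (resProj B).trace = Fintype.card n - Fintype.card κ := by
  rw [resProj, trace_sub, trace_mul_comm, Matrix.mul_assoc, nonsing_inv_mul _ hB, trace_one, trace_one]

lemma resProj_orthogonal_mul {O : Matrix n n ℝ} (hO : Oᵀ * O = 1) (B : Matrix n κ ℝ) :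
    resProj (O * B) = O * resProj B * Oᵀ := by
  have hO' : O * Oᵀ = 1 := mul_eq_one_comm.mp hO
  have h : (O * B)ᵀ * (O * B) = Bᵀ * B := by
    rw [transpose_mul, Matrix.mul_assoc, ← Matrix.mul_assoc Oᵀ, hO, Matrix.one_mul]
  rw [resProj, h, resProj, mul_sub, mul_one, sub_mul, hO', transpose_mul]
  simp only [Matrix.mul_assoc]

lemma isUnit_det_gram (B : Matrix n κ ℝ) (hB : LinearIndependent ℝ B.col) :
    IsUnit (Bᵀ * B).det := by
  have h := PosDef.conjTranspose_mul_self B (mulVec_injective_iff.mpr hB)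
  rw [conjTranspose_eq_transpose_of_trivial] at h
  exact h.isUnit.map detMonoidHom

lemma measurable_gram_inv_mul_transpose_apply {Ω : Type*} [TopologicalSpace Ω] [MeasurableSpace Ω]
    [BorelSpace Ω] {B : Ω → Matrix n κ ℝ} (hB : Continuous B) (p : κ) (l : n) :
    Measurable fun x => (((B x)ᵀ * B x)⁻¹ * (B x)ᵀ) p l := by
  simp only [mul_apply, transpose_apply]
  refine Finset.measurable_sum _ fun q _ => Measurable.mul ?_ (hB.matrix_elem l q).measurable
  have hc : Continuous fun x => (B x)ᵀ * B x := hB.matrix_transpose.matrix_mul hB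
  have : ∀ x, ((B x)ᵀ * B x)⁻¹ p q = (((B x)ᵀ * B x).det)⁻¹ * ((B x)ᵀ * B x).adjugate p q := by
    intro x
    rw [inv_def, Ring.inverse_eq_inv', Matrix.smul_apply, smul_eq_mul]
  simp_rw [this]
  exact hc.matrix_det.measurable.inv.mul (hc.matrix_adjugate.matrix_elem p q).measurable

lemma measurable_resProj_apply {Ω : Type*} [TopologicalSpace Ω] [MeasurableSpace Ω] [BorelSpace Ω]
    {B : Ω → Matrix n κ ℝ} (hB : Continuous B) (l l' : n) :
    Measurable fun x => resProj (B x) l l' := by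
  simp only [resProj, Matrix.sub_apply, mul_apply (M := B _)]
  exact measurable_const.sub (Finset.measurable_sum _ fun p _ =>
    (hB.matrix_elem l p).measurable.mul (measurable_gram_inv_mul_transpose_apply hB p l'))

end ResProj

section Columns

variable {ι n : Type*} [Fintype ι] [DecidableEq ι] [Fintype n] [DecidableEq n]

/-- The matrix with columns `y j`. -/
def colsMat (y : ι → n → ℝ) : Matrix n ι ℝ := fun l j => y j l

/-- The projection onto the orthogonal complement of the span of the `y j` with `j ≠ i`. -/
noncomputable def complProj (y : ι → n → ℝ) (i : ι) : Matrix n n ℝ :=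
  resProj (colsMat fun j : {j // j ≠ i} => y j)

lemma complProj_congr {y y' : ι → n → ℝ} {i : ι} (h : ∀ j ≠ i, y j = y' j) :
    complProj y i = complProj y' i := by
  have : (fun j : {j // j ≠ i} => y j) = fun j : {j // j ≠ i} => y' j := funext fun j => h j j.2
  rw [complProj, complProj, this]

lemma transpose_complProj (y : ι → n → ℝ) (i : ι) : (complProj y i)ᵀ = complProj y i :=
  transpose_resProj _

lemma complProj_mul_self (y : ι → n → ℝ) (i : ι) :
    complProj y i * complProj y i = complProj y i :=
  resProj_mul_self _

lemma isUnit_det_others {y : ι → n → ℝ} (hy : LinearIndependent ℝ y) (i : ι) :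
    IsUnit ((colsMat fun j : {j // j ≠ i} => y j)ᵀ * (colsMat fun j : {j // j ≠ i} => y j)).det :=
  isUnit_det_gram _ (hy.comp _ Subtype.val_injective)

lemma complProj_mulVec {y : ι → n → ℝ} (hy : LinearIndependent ℝ y) {i j : ι} (hj : j ≠ i) :
    complProj y i *ᵥ y j = 0 := by
  have h := resProj_mul _ (isUnit_det_others hy i)
  ext l
  exact congrFun (congrFun h l) ⟨j, hj⟩

lemma trace_complProj {y : ι → n → ℝ} (hy : LinearIndependent ℝ y) (i : ι) :
    (complProj y i).trace = Fintype.card n - Fintype.card ι + 1 := by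
  rw [complProj, trace_resProj _ (isUnit_det_others hy i), Fintype.card_subtype_compl,
    Fintype.card_subtype_eq, Nat.cast_sub (Fintype.card_pos_iff.mpr ⟨i⟩)]
  push_cast
  ring

lemma complProj_orthogonal {O : Matrix n n ℝ} (hO : Oᵀ * O = 1) (y : ι → n → ℝ) (i : ι) :
    complProj (fun j => O *ᵥ y j) i = O * complProj y i * Oᵀ := by
  rw [complProj, complProj, ← resProj_orthogonal_mul hO]
  rfl

lemma measurable_complProj_apply (m : ι → n → ℝ) (i : ι) (l l' : n) :
    Measurable fun A : ι → n → ℝ => complProj (m + A) i l l' := by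
  refine measurable_resProj_apply ?_ l l'
  unfold colsMat
  refine continuous_pi fun _ => continuous_pi fun _ => ?_
  simp only [Pi.add_apply]
  fun_prop

lemma complProj_dotProduct_self (y : ι → n → ℝ) (i : ι) (x : n → ℝ) :
    (complProj y i *ᵥ x) ⬝ᵥ (complProj y i *ᵥ x) = x ⬝ᵥ (complProj y i *ᵥ x) := by
  rw [dotProduct_mulVec, vecMul_mulVec, transpose_complProj, complProj_mul_self,
    ← mulVec_transpose, transpose_complProj, dotProduct_comm]

lemma complProj_dotProduct_comm (y : ι → n → ℝ) (i : ι) (x z : n → ℝ) :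
    (complProj y i *ᵥ x) ⬝ᵥ z = x ⬝ᵥ (complProj y i *ᵥ z) := by
  rw [dotProduct_mulVec, ← mulVec_transpose, transpose_complProj]

lemma gram_inv_mul_transpose_mulVec {y : ι → n → ℝ} (hy : LinearIndependent ℝ y) (i : ι)
    (z : n → ℝ) :
    ((((colsMat y)ᵀ * colsMat y)⁻¹ * (colsMat y)ᵀ) *ᵥ z) i =
      (y i ⬝ᵥ (complProj y i *ᵥ y i))⁻¹ * (y i ⬝ᵥ (complProj y i *ᵥ z)) := by
  set G := (colsMat y)ᵀ * colsMat y with hG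
  have hGu : IsUnit G.det := isUnit_det_gram _ hy
  set g : n → ℝ := (G⁻¹ * (colsMat y)ᵀ) i with hg
  have hgsum : g = ∑ j, G⁻¹ i j • y j := by
    ext l
    simp [hg, mul_apply, colsMat, Finset.sum_apply]
  have hdual : ∀ j, g ⬝ᵥ y j = if i = j then 1 else 0 := by
    intro j
    have h : G⁻¹ * (colsMat y)ᵀ * colsMat y = 1 := by
      rw [Matrix.mul_assoc, nonsing_inv_mul _ hGu]
    have := congrFun (congrFun h i) j
    rw [one_apply, mul_apply] at this
    exact this
  have hQg : complProj y i *ᵥ g = g := by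
    have h0 : (colsMat fun j : {j // j ≠ i} => y j)ᵀ *ᵥ g = 0 := by
      ext j
      have := hdual j
      rw [if_neg (Ne.symm j.2), dotProduct_comm] at this
      exact this
    rw [complProj, resProj, sub_mulVec, one_mulVec, ← mulVec_mulVec, ← mulVec_mulVec, h0]
    simp
  have hQg' : complProj y i *ᵥ g = G⁻¹ i i • (complProj y i *ᵥ y i) := by
    rw [hgsum, mulVec_sum, Finset.sum_eq_single i]
    · rw [mulVec_smul]
    · intro j _ hj
      rw [mulVec_smul, complProj_mulVec hy hj, smul_zero]
    · simp
  have hD : G⁻¹ i i * (y i ⬝ᵥ (complProj y i *ᵥ y i)) = 1 := by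
    have := hdual i
    rw [if_pos rfl, ← hQg, hQg', smul_dotProduct, smul_eq_mul, complProj_dotProduct_comm] at this
    exact this
  calc ((G⁻¹ * (colsMat y)ᵀ) *ᵥ z) i = g ⬝ᵥ z := rfl
    _ = G⁻¹ i i * (y i ⬝ᵥ (complProj y i *ᵥ z)) := by
      rw [← hQg, hQg', smul_dotProduct, smul_eq_mul, complProj_dotProduct_comm]
    _ = _ := by rw [eq_inv_of_mul_eq_one_left hD]

end Columns

section Projections

variable {n : Type*} [Fintype n]

lemma trace_transpose_mul_self_nonneg (X : Matrix n n ℝ) : 0 ≤ (Xᵀ * X).trace := by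
  simp only [trace, diag_apply, mul_apply, transpose_apply]
  exact Finset.sum_nonneg fun _ _ => Finset.sum_nonneg fun _ _ => mul_self_nonneg _

lemma dotProduct_mulVec_projection {P : Matrix n n ℝ} (hP : Pᵀ = P) (hPP : P * P = P)
    (x : n → ℝ) : (P *ᵥ x) ⬝ᵥ (P *ᵥ x) = x ⬝ᵥ (P *ᵥ x) := by
  rw [dotProduct_mulVec, vecMul_mulVec, hP, hPP, ← mulVec_transpose, hP, dotProduct_comm]

lemma dotProduct_mulVec_symm {P : Matrix n n ℝ} (hP : Pᵀ = P) (x y : n → ℝ) :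
    (P *ᵥ x) ⬝ᵥ y = x ⬝ᵥ (P *ᵥ y) := by
  rw [dotProduct_mulVec, ← mulVec_transpose, hP]

lemma dotProduct_self_nonneg' (x : n → ℝ) : 0 ≤ x ⬝ᵥ x :=
  Finset.sum_nonneg fun _ _ => mul_self_nonneg _

variable [DecidableEq n]

lemma projection_compl {P : Matrix n n ℝ} (hP : Pᵀ = P) (hPP : P * P = P) :
    (1 - P)ᵀ = 1 - P ∧ (1 - P) * (1 - P) = 1 - P := by
  refine ⟨by rw [transpose_sub, transpose_one, hP], ?_⟩
  rw [sub_mul, mul_sub, mul_sub, hPP]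
  simp

lemma dotProduct_mulVec_projection_le {P : Matrix n n ℝ} (hP : Pᵀ = P) (hPP : P * P = P)
    (x : n → ℝ) : x ⬝ᵥ (P *ᵥ x) ≤ x ⬝ᵥ x := by
  obtain ⟨h1, h2⟩ := projection_compl hP hPP
  have h := dotProduct_mulVec_projection h1 h2 x
  have h0 := dotProduct_self_nonneg' ((1 - P) *ᵥ x)
  rw [h, sub_mulVec, one_mulVec, dotProduct_sub] at h0
  linarith

lemma dotProduct_mulVec_projection_nonneg {P : Matrix n n ℝ} (hP : Pᵀ = P) (hPP : P * P = P)
    (x : n → ℝ) : 0 ≤ x ⬝ᵥ (P *ᵥ x) := by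
  rw [← dotProduct_mulVec_projection hP hPP]; exact dotProduct_self_nonneg' _

lemma trace_projection_mul_le {P : Matrix n n ℝ} (hP : Pᵀ = P) (hPP : P * P = P)
    (X : Matrix n n ℝ) : ((P * X)ᵀ * (P * X)).trace ≤ (Xᵀ * X).trace := by
  obtain ⟨h1, h2⟩ := projection_compl hP hPP
  have h0 := trace_transpose_mul_self_nonneg ((1 - P) * X)
  have e1 : ∀ {R : Matrix n n ℝ}, Rᵀ = R → R * R = R → (R * X)ᵀ * (R * X) = Xᵀ * R * X := by
    intro R hR hRR
    rw [transpose_mul, hR, mul_assoc, ← mul_assoc R R, hRR, ← mul_assoc]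
  rw [e1 h1 h2, mul_sub, mul_one, sub_mul, trace_sub, ← e1 hP hPP] at h0
  linarith

lemma trace_projection_mul_projection {P Q : Matrix n n ℝ} (hP : Pᵀ = P) (hPP : P * P = P)
    (hQ : Qᵀ = Q) (hQQ : Q * Q = Q) : 0 ≤ (P * Q).trace ∧ (P * Q).trace ≤ P.trace ∧
      (P * Q).trace ≤ Q.trace := by
  have h1 : (P * Q).trace = ((P * Q)ᵀ * (P * Q)).trace := by
    rw [transpose_mul, hP, hQ, mul_assoc, ← mul_assoc P P, hPP, trace_mul_comm Q,
      mul_assoc, hQQ]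
  have h2 : (P * Q).trace = ((Q * P)ᵀ * (Q * P)).trace := by
    rw [transpose_mul, hP, hQ, mul_assoc, ← mul_assoc Q Q, hQQ,
      trace_mul_comm P (Q * P), mul_assoc, hPP, trace_mul_comm]
  refine ⟨h1 ▸ trace_transpose_mul_self_nonneg _, ?_, ?_⟩
  · rw [h2]
    refine (trace_projection_mul_le hQ hQQ P).trans_eq ?_
    rw [hP, hPP]
  · rw [h1]
    refine (trace_projection_mul_le hP hPP Q).trans_eq ?_
    rw [hQ, hQQ]

lemma trace_sq_compression_le {P Q : Matrix n n ℝ} (hP : Pᵀ = P) (hPP : P * P = P)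
    (hQ : Qᵀ = Q) (hQQ : Q * Q = Q) {k : ℝ} (hk0 : 0 ≤ k) (hk1 : k ≤ 1) :
    ((P * Q * P - k • P) * (P * Q * P - k • P)).trace ≤ 2 * P.trace := by
  have hPQ := trace_projection_mul_projection hP hPP hQ hQQ
  have hP0 : 0 ≤ P.trace := hPQ.1.trans hPQ.2.1
  have e1 : P * Q * P * P = P * Q * P := by rw [mul_assoc, hPP]
  have e2 : P * (P * Q * P) = P * Q * P := by rw [mul_assoc, ← mul_assoc P P, hPP, ← mul_assoc]
  have e3 : (P * Q * P).trace = (P * Q).trace := by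
    rw [trace_mul_comm, ← mul_assoc, hPP]
  have e4 : (P * Q * P * (P * Q * P)).trace ≤ P.trace := by
    have h : P * Q * P * (P * Q * P) = (P * (Q * P))ᵀ * (P * (Q * P)) := by
      rw [transpose_mul, transpose_mul, hP, hQ, ← mul_assoc P Q P]
    rw [h]
    refine (trace_projection_mul_le hP hPP _).trans ((trace_projection_mul_le hQ hQQ _).trans_eq ?_)
    rw [hP, hPP]
  rw [sub_mul, mul_sub, mul_sub, mul_smul_comm, smul_mul_assoc, smul_mul_smul_comm, e1, e2, hPP]
  simp only [trace_sub, trace_smul, smul_eq_mul, e3]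
  have : k * k ≤ 1 := by nlinarith
  nlinarith [mul_nonneg hk0 hPQ.1]

lemma exists_orthogonal_mulVec_eq {P : Matrix n n ℝ} (hP : Pᵀ = P) {u w : n → ℝ}
    (hu : u ⬝ᵥ u = 1) (hPu : P *ᵥ u = u) (hPw : P *ᵥ w = w) :
    ∃ O : Matrix n n ℝ, Oᵀ * O = 1 ∧ Oᵀ = O ∧ O *ᵥ w = √(w ⬝ᵥ w) • u ∧
      ∀ p, P *ᵥ p = 0 → O *ᵥ p = p := by
  set s := √(w ⬝ᵥ w) with hs
  have hss : s * s = w ⬝ᵥ w := Real.mul_self_sqrt (dotProduct_self_nonneg' w)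
  set x := s • u - w with hx
  have hPx : P *ᵥ x = x := by rw [hx, mulVec_sub, mulVec_smul, hPu, hPw]
  have hOv : ∀ y, (1 - (2 / (x ⬝ᵥ x)) • vecMulVec x x) *ᵥ y =
      y - (2 / (x ⬝ᵥ x) * (x ⬝ᵥ y)) • x := by
    intro y
    rw [sub_mulVec, one_mulVec, smul_mulVec, vecMulVec_mulVec]
    ext l
    simp
    ring
  refine ⟨1 - (2 / (x ⬝ᵥ x)) • vecMulVec x x, ?_, ?_, ?_, ?_⟩
  · rw [transpose_sub, transpose_one, transpose_smul, transpose_vecMulVec, sub_mul, mul_sub, mul_sub,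
      one_mul, one_mul, mul_one, smul_mul_smul_comm, vecMulVec_mul_vecMulVec]
    by_cases h : x ⬝ᵥ x = 0
    · simp [h]
    · ext a b
      simp [vecMulVec_apply]
      field_simp
      ring
  · rw [transpose_sub, transpose_one, transpose_smul, transpose_vecMulVec]
  · rw [hOv]
    have h1 : x ⬝ᵥ x = -2 * (x ⬝ᵥ w) := by
      simp only [hx, sub_dotProduct, dotProduct_sub, smul_dotProduct, dotProduct_smul, smul_eq_mul,
        hu, dotProduct_comm w u]
      linarith
    by_cases h : x ⬝ᵥ x = 0
    · have hx0 : x = 0 := dotProduct_self_eq_zero.mp h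
      rw [hx0, smul_zero, sub_zero]
      exact (sub_eq_zero.mp (hx ▸ hx0)).symm
    · have : 2 / (x ⬝ᵥ x) * (x ⬝ᵥ w) = -1 := by
        field_simp
        linarith
      rw [this, hx]
      simp
  · intro p hp
    rw [hOv]
    have : x ⬝ᵥ p = 0 := by
      rw [← hPx, dotProduct_mulVec_symm hP, hp, dotProduct_zero]
    simp [this]

end Projections

lemma measurable_dotProduct_mulVec {Ω n : Type*} [MeasurableSpace Ω] [Fintype n]
    {f g : Ω → n → ℝ} {M : Ω → Matrix n n ℝ} (hf : Measurable f) (hg : Measurable g)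
    (hM : ∀ l l', Measurable fun x => M x l l') :
    Measurable fun x => f x ⬝ᵥ (M x *ᵥ g x) := by
  simp only [dotProduct, mulVec]
  refine Finset.measurable_sum _ fun p _ => ((measurable_pi_apply p).comp hf).mul ?_
  exact Finset.measurable_sum _ fun q _ => (hM p q).mul ((measurable_pi_apply q).comp hg)

section Invariance

variable {ι n : Type*} [Fintype ι] [DecidableEq ι] [Fintype n] [DecidableEq n]
  (v : NNReal) (m : ι → n → ℝ) (i : ι)

lemma lintegral_complProj_conj {O : Matrix n n ℝ} (hO : Oᵀ * O = 1)
    (hm : ∀ j ≠ i, O *ᵥ m j = m j) {F : Matrix n n ℝ → ENNReal}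
    (hF : Measurable fun A : ι → n → ℝ => F (complProj (m + A) i)) :
    ∫⁻ A, F (O * complProj (m + A) i * Oᵀ) ∂(Measure.pi fun _ : ι => gaussVec n v) =
      ∫⁻ A, F (complProj (m + A) i) ∂(Measure.pi fun _ : ι => gaussVec n v) := by
  have hmp : MeasurePreserving (fun (A : ι → n → ℝ) j => O *ᵥ A j)
      (Measure.pi fun _ : ι => gaussVec n v) (Measure.pi fun _ : ι => gaussVec n v) :=
    measurePreserving_pi _ _ fun _ => measurePreserving_gaussVec_mulVec v hO
  rw [← hmp.lintegral_comp hF]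
  refine lintegral_congr fun A => ?_
  rw [← complProj_orthogonal hO]
  congr 1
  refine complProj_congr fun j hj => ?_
  simp [mulVec_add, hm j hj]

variable {P : Matrix n n ℝ} (hP : Pᵀ = P) (hPP : P * P = P) (hPm : ∀ j ≠ i, P *ᵥ m j = 0)
  {u : n → ℝ} (hu : u ⬝ᵥ u = 1) (hPu : P *ᵥ u = u)

include hP hPm hu hPu in
lemma lintegral_quadraticForm_complProj_eq (k : ℝ) {w : n → ℝ} (hPw : P *ᵥ w = w) :
    ∫⁻ A, ENNReal.ofReal ((w ⬝ᵥ (complProj (m + A) i *ᵥ w) - k * (w ⬝ᵥ w)) ^ 2)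
      ∂(Measure.pi fun _ : ι => gaussVec n v) = ENNReal.ofReal ((w ⬝ᵥ w) ^ 2) *
    ∫⁻ A, ENNReal.ofReal ((u ⬝ᵥ (complProj (m + A) i *ᵥ u) - k) ^ 2)
      ∂(Measure.pi fun _ : ι => gaussVec n v) := by
  obtain ⟨O, hO, hOt, hOw, hOp⟩ := exists_orthogonal_mulVec_eq hP hu hPu hPw
  have hmeas : ∀ x : n → ℝ, Measurable fun A : ι → n → ℝ => x ⬝ᵥ (complProj (m + A) i *ᵥ x) :=
    fun x => measurable_dotProduct_mulVec measurable_const measurable_const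
      (measurable_complProj_apply m i)
  rw [← lintegral_complProj_conj v m i hO (fun j hj => hOp _ (hPm j hj))
    (F := fun Q => ENNReal.ofReal ((w ⬝ᵥ (Q *ᵥ w) - k * (w ⬝ᵥ w)) ^ 2))
    (by have := hmeas w; fun_prop),
    ← lintegral_const_mul _ (by have := hmeas u; fun_prop)]
  refine lintegral_congr fun A => ?_
  rw [← ENNReal.ofReal_mul (by positivity)]
  congr 1
  rw [hOt, ← mulVec_mulVec, ← mulVec_mulVec, ← dotProduct_mulVec_symm hOt, hOw, mulVec_smul,
    smul_dotProduct, dotProduct_smul, smul_eq_mul, smul_eq_mul, ← mul_assoc,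
    Real.mul_self_sqrt (dotProduct_self_nonneg' w)]
  ring

include hP hPm hu hPu in
lemma lintegral_bilinForm_complProj_eq {w z : n → ℝ} (hPw : P *ᵥ w = w) (hPz : P *ᵥ z = 0) :
    ∫⁻ A, ENNReal.ofReal ((w ⬝ᵥ (complProj (m + A) i *ᵥ z)) ^ 2)
      ∂(Measure.pi fun _ : ι => gaussVec n v) = ENNReal.ofReal (w ⬝ᵥ w) *
    ∫⁻ A, ENNReal.ofReal ((u ⬝ᵥ (complProj (m + A) i *ᵥ z)) ^ 2)
      ∂(Measure.pi fun _ : ι => gaussVec n v) := by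
  obtain ⟨O, hO, hOt, hOw, hOp⟩ := exists_orthogonal_mulVec_eq hP hu hPu hPw
  have hmeas : ∀ x : n → ℝ, Measurable fun A : ι → n → ℝ => x ⬝ᵥ (complProj (m + A) i *ᵥ z) :=
    fun x => measurable_dotProduct_mulVec measurable_const measurable_const
      (measurable_complProj_apply m i)
  rw [← lintegral_complProj_conj v m i hO (fun j hj => hOp _ (hPm j hj))
    (F := fun Q => ENNReal.ofReal ((w ⬝ᵥ (Q *ᵥ z)) ^ 2))
    (by have := hmeas w; fun_prop),
    ← lintegral_const_mul _ (by have := hmeas u; fun_prop)]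
  refine lintegral_congr fun A => ?_
  rw [← ENNReal.ofReal_mul (dotProduct_self_nonneg' w)]
  congr 1
  rw [hOt, ← mulVec_mulVec, ← mulVec_mulVec, ← dotProduct_mulVec_symm hOt, hOw, hOp z hPz,
    smul_dotProduct, smul_eq_mul, mul_pow, Real.sq_sqrt (dotProduct_self_nonneg' w)]

variable (n) in
lemma lintegral_dotProduct_projection_le (hPP : P * P = P) (hP : Pᵀ = P) :
    ENNReal.ofReal P.trace ≤
      ∫⁻ g, ENNReal.ofReal ((P *ᵥ g) ⬝ᵥ (P *ᵥ g)) ∂(gaussVec n 1) := by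
  obtain ⟨h1, h2, -⟩ := quadraticForm_gaussVec 1 hP
  have h0 : ∀ g, 0 ≤ g ⬝ᵥ (P *ᵥ g) := dotProduct_mulVec_projection_nonneg hP hPP
  simp_rw [dotProduct_mulVec_projection hP hPP]
  rw [← ofReal_integral_eq_lintegral_ofReal (h1.integrable (by norm_num)) (ae_of_all _ h0), h2]
  simp

lemma lintegral_dotProduct_projection_sq_le (hPP : P * P = P) (hP : Pᵀ = P) :
    ENNReal.ofReal (P.trace ^ 2) ≤
      ∫⁻ g, ENNReal.ofReal (((P *ᵥ g) ⬝ᵥ (P *ᵥ g)) ^ 2) ∂(gaussVec n 1) := by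
  have h := lintegral_quadraticForm_sub_sq 1 hP 0
  simp only [sub_zero] at h
  simp_rw [dotProduct_mulVec_projection hP hPP, h]
  refine ENNReal.ofReal_le_ofReal ?_
  have h1 := trace_transpose_mul_self_nonneg P
  rw [hP] at h1
  have h2 := mul_nonneg gaussSqVar_nonneg h1
  simp
  linarith

include hP hPP hPm hu hPu in
lemma lintegral_bilinForm_complProj_le (hP0 : 0 < P.trace) {z : n → ℝ} (hz : z ⬝ᵥ z = 1)
    (hPz : P *ᵥ z = 0) :
    ∫⁻ A, ENNReal.ofReal ((u ⬝ᵥ (complProj (m + A) i *ᵥ z)) ^ 2)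
      ∂(Measure.pi fun _ : ι => gaussVec n v) ≤ ENNReal.ofReal (1 / P.trace) := by
  set β := ∫⁻ A, ENNReal.ofReal ((u ⬝ᵥ (complProj (m + A) i *ᵥ z)) ^ 2)
      ∂(Measure.pi fun _ : ι => gaussVec n v) with hβ
  have key : ENNReal.ofReal P.trace * β ≤ 1 := by
    calc ENNReal.ofReal P.trace * β
        ≤ (∫⁻ g, ENNReal.ofReal ((P *ᵥ g) ⬝ᵥ (P *ᵥ g)) ∂(gaussVec n 1)) * β := by
          gcongr; exact lintegral_dotProduct_projection_le n hPP hP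
      _ = ∫⁻ g, ∫⁻ A, ENNReal.ofReal (((P *ᵥ g) ⬝ᵥ (complProj (m + A) i *ᵥ z)) ^ 2)
            ∂(Measure.pi fun _ : ι => gaussVec n v) ∂(gaussVec n 1) := by
          rw [← lintegral_mul_const _ (by
            have : Measurable fun g : n → ℝ => P *ᵥ g := by
              exact (LinearMap.toContinuousLinearMap (Matrix.mulVecLin P)).continuous.measurable
            simp only [dotProduct]; fun_prop)]
          refine lintegral_congr fun g => ?_
          rw [lintegral_bilinForm_complProj_eq v m i hP hPm hu hPu (w := P *ᵥ g)
            (by rw [mulVec_mulVec, hPP]) hPz]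
      _ = ∫⁻ A, ∫⁻ g, ENNReal.ofReal (((P *ᵥ g) ⬝ᵥ (complProj (m + A) i *ᵥ z)) ^ 2)
            ∂(gaussVec n 1) ∂(Measure.pi fun _ : ι => gaussVec n v) := by
          refine lintegral_lintegral_swap (Measurable.aemeasurable ?_)
          have : Measurable fun p : (n → ℝ) × (ι → n → ℝ) =>
              (P *ᵥ p.1) ⬝ᵥ (complProj (m + p.2) i *ᵥ z) :=
            measurable_dotProduct_mulVec
              ((LinearMap.toContinuousLinearMap (Matrix.mulVecLin P)).continuous.measurable.comp
                measurable_fst) measurable_const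
              fun l l' => (measurable_complProj_apply m i l l').comp measurable_snd
          simp only [Function.uncurry_def]
          fun_prop
      _ ≤ ∫⁻ A, 1 ∂(Measure.pi fun _ : ι => gaussVec n v) := by
          refine lintegral_mono fun A => ?_
          simp_rw [dotProduct_mulVec_symm hP]
          rw [lintegral_dotProduct_sq, ← ENNReal.ofReal_one]
          refine ENNReal.ofReal_le_ofReal ?_
          rw [dotProduct_mulVec_projection hP hPP]
          have h1 := dotProduct_mulVec_projection_le hP hPP (complProj (m + A) i *ᵥ z)
          have h2 := dotProduct_mulVec_projection_le (transpose_complProj (m + A) i)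
            (complProj_mul_self (m + A) i) z
          rw [← complProj_dotProduct_self, hz] at h2
          push_cast
          linarith
      _ = 1 := by simp
  rw [one_div, ENNReal.ofReal_inv_of_pos hP0, ENNReal.le_inv_iff_mul_le, mul_comm]
  exact key

include hP hPP hPm hu hPu in
lemma lintegral_quadraticForm_complProj_le (hv : v ≠ 0)
    (hcard : Fintype.card ι ≤ Fintype.card n) (hP0 : 0 < P.trace) {k : ℝ} (hk0 : 0 ≤ k)
    (hk1 : k ≤ 1) :
    ∫⁻ A, ENNReal.ofReal ((u ⬝ᵥ (complProj (m + A) i *ᵥ u) - k) ^ 2)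
      ∂(Measure.pi fun _ : ι => gaussVec n v) ≤
    ENNReal.ofReal ((2 * gaussSqVar * P.trace +
      (|(Fintype.card n - Fintype.card ι + 1 : ℝ) - k * Fintype.card n| +
        (Fintype.card n - P.trace)) ^ 2) / P.trace ^ 2) := by
  set α := ∫⁻ A, ENNReal.ofReal ((u ⬝ᵥ (complProj (m + A) i *ᵥ u) - k) ^ 2)
      ∂(Measure.pi fun _ : ι => gaussVec n v) with hα
  set b := 2 * gaussSqVar * P.trace +
      (|(Fintype.card n - Fintype.card ι + 1 : ℝ) - k * Fintype.card n| +
        (Fintype.card n - P.trace)) ^ 2 with hb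
  have key : ENNReal.ofReal (P.trace ^ 2) * α ≤ ENNReal.ofReal b := by
    calc ENNReal.ofReal (P.trace ^ 2) * α
        ≤ (∫⁻ g, ENNReal.ofReal (((P *ᵥ g) ⬝ᵥ (P *ᵥ g)) ^ 2) ∂(gaussVec n 1)) * α := by
          gcongr; exact lintegral_dotProduct_projection_sq_le hPP hP
      _ = ∫⁻ g, ∫⁻ A, ENNReal.ofReal (((P *ᵥ g) ⬝ᵥ (complProj (m + A) i *ᵥ (P *ᵥ g)) -
            k * ((P *ᵥ g) ⬝ᵥ (P *ᵥ g))) ^ 2)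
            ∂(Measure.pi fun _ : ι => gaussVec n v) ∂(gaussVec n 1) := by
          rw [← lintegral_mul_const _ (by
            have : Measurable fun g : n → ℝ => P *ᵥ g := by
              exact (LinearMap.toContinuousLinearMap (Matrix.mulVecLin P)).continuous.measurable
            simp only [dotProduct]; fun_prop)]
          refine lintegral_congr fun g => ?_
          rw [lintegral_quadraticForm_complProj_eq v m i hP hPm hu hPu k (w := P *ᵥ g)
            (by rw [mulVec_mulVec, hPP])]
      _ = ∫⁻ A, ∫⁻ g, ENNReal.ofReal (((P *ᵥ g) ⬝ᵥ (complProj (m + A) i *ᵥ (P *ᵥ g)) -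
            k * ((P *ᵥ g) ⬝ᵥ (P *ᵥ g))) ^ 2)
            ∂(gaussVec n 1) ∂(Measure.pi fun _ : ι => gaussVec n v) := by
          refine lintegral_lintegral_swap (Measurable.aemeasurable ?_)
          have hPg : Measurable fun p : (n → ℝ) × (ι → n → ℝ) => P *ᵥ p.1 :=
            (LinearMap.toContinuousLinearMap (Matrix.mulVecLin P)).continuous.measurable.comp
                measurable_fst
          have h1 : Measurable fun p : (n → ℝ) × (ι → n → ℝ) =>
              (P *ᵥ p.1) ⬝ᵥ (complProj (m + p.2) i *ᵥ (P *ᵥ p.1)) :=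
            measurable_dotProduct_mulVec hPg hPg
              fun l l' => (measurable_complProj_apply m i l l').comp measurable_snd
          have h2 : Measurable fun p : (n → ℝ) × (ι → n → ℝ) => (P *ᵥ p.1) ⬝ᵥ (P *ᵥ p.1) := by
            simp only [dotProduct]; fun_prop
          simp only [Function.uncurry_def]
          fun_prop
      _ ≤ ∫⁻ A, ENNReal.ofReal b ∂(Measure.pi fun _ : ι => gaussVec n v) := by
          refine lintegral_mono_ae ?_
          filter_upwards [ae_linearIndependent hv hcard m] with A hA
          set Q := complProj (m + A) i with hQdef
          have hQ : Qᵀ = Q := transpose_complProj _ _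
          have hQQ : Q * Q = Q := complProj_mul_self _ _
          have hM : (P * Q * P - k • P)ᵀ = P * Q * P - k • P := by
            simp only [transpose_sub, transpose_mul, transpose_smul, hP, hQ, mul_assoc]
          have hform : ∀ g, (P *ᵥ g) ⬝ᵥ (Q *ᵥ (P *ᵥ g)) - k * ((P *ᵥ g) ⬝ᵥ (P *ᵥ g)) =
              g ⬝ᵥ ((P * Q * P - k • P) *ᵥ g) - 0 := by
            intro g
            rw [dotProduct_mulVec_projection hP hPP, dotProduct_mulVec_symm hP, sub_mulVec,
              dotProduct_sub, smul_mulVec, dotProduct_smul, mulVec_mulVec, mulVec_mulVec,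
              smul_eq_mul, sub_zero]
          simp_rw [hform]
          rw [lintegral_quadraticForm_sub_sq 1 hM 0]
          refine ENNReal.ofReal_le_ofReal ?_
          have h1 := trace_sq_compression_le hP hPP hQ hQQ hk0 hk1
          have hτ : Q.trace = Fintype.card n - Fintype.card ι + 1 := trace_complProj hA i
          obtain ⟨hc, hcc⟩ := projection_compl hP hPP
          have h2 := trace_projection_mul_projection hc hcc hQ hQQ
          have h3 := trace_projection_mul_projection hP hPP hQ hQQ
          rw [sub_mul, one_mul, trace_sub, trace_sub, trace_one] at h2
          have e3 : (P * Q * P).trace = (P * Q).trace := by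
            rw [trace_mul_comm, ← mul_assoc, hPP]
          have h4 : |(P * Q * P - k • P).trace| ≤
              |(Fintype.card n - Fintype.card ι + 1 : ℝ) - k * Fintype.card n| +
                (Fintype.card n - P.trace) := by
            have hρ : 0 ≤ Fintype.card n - P.trace := h2.1.trans h2.2.1
            rw [trace_sub, trace_smul, e3, smul_eq_mul, ← hτ]
            have hkρ : k * (Fintype.card n - P.trace) ≤ Fintype.card n - P.trace := by nlinarith
            have hkρ0 : 0 ≤ k * (Fintype.card n - P.trace) := by positivity
            rcases abs_cases (Q.trace - k * Fintype.card n) with h | h <;>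
            rw [abs_le] <;> constructor <;> nlinarith
          have h5 := pow_le_pow_left₀ (abs_nonneg _) h4 2
          rw [sq_abs] at h5
          have h6 := mul_le_mul_of_nonneg_left h1 gaussSqVar_nonneg
          rw [hb]
          push_cast
          simp only [one_pow, mul_one, one_mul, sub_zero]
          linarith
      _ = ENNReal.ofReal b := by simp
  rw [ENNReal.ofReal_div_of_pos (by positivity), ENNReal.le_div_iff_mul_le
    (by left; simp; positivity) (by left; simp), mul_comm]
  exact key

end Invariance

section MeanLE

variable {Ω : Type*} [MeasurableSpace Ω] {μ : Measure Ω}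

/-- The measurable function `f` has mean at most `F ≥ 0` (in the sense of the Lebesgue integral of
its positive part). -/
def MeanLE (μ : Measure Ω) (f : Ω → ℝ) (F : ℝ) : Prop :=
  0 ≤ F ∧ Measurable f ∧ ∫⁻ x, ENNReal.ofReal (f x) ∂μ ≤ ENNReal.ofReal F

lemma MeanLE.add {f g : Ω → ℝ} {F G : ℝ} (hf : MeanLE μ f F) (hg : MeanLE μ g G) :
    MeanLE μ (fun x => f x + g x) (F + G) := by
  refine ⟨add_nonneg hf.1 hg.1, hf.2.1.add hg.2.1, ?_⟩
  rw [ENNReal.ofReal_add hf.1 hg.1]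
  refine (lintegral_mono fun x => ENNReal.ofReal_add_le).trans ?_
  rw [lintegral_add_left (by have := hf.2.1; fun_prop)]
  exact add_le_add hf.2.2 hg.2.2

lemma MeanLE.const_mul {f : Ω → ℝ} {F c : ℝ} (hf : MeanLE μ f F) (hc : 0 ≤ c) :
    MeanLE μ (fun x => c * f x) (c * F) := by
  refine ⟨mul_nonneg hc hf.1, hf.2.1.const_mul c, ?_⟩
  rw [ENNReal.ofReal_mul hc]
  simp_rw [ENNReal.ofReal_mul hc]
  rw [lintegral_const_mul _ (by have := hf.2.1; fun_prop)]
  gcongr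
  exact hf.2.2

lemma meanLE_const [IsProbabilityMeasure μ] {c : ℝ} (hc : 0 ≤ c) : MeanLE μ (fun _ => c) c :=
  ⟨hc, measurable_const, by simp⟩

end MeanLE

lemma sq_inv_mul_sub_le {D ν t D₀ ε : ℝ} (hD : 0 ≤ D) (hν : ν ^ 2 ≤ D) (hD₀ : 0 < D₀) (hε : 0 < ε)
    (hε1 : ε ≤ 1) :
    (D⁻¹ * ν - t) ^ 2 ≤ 8 / D₀ ^ 2 * (ν - t * D₀) ^ 2 +
      (16 * t ^ 2 + 2) / (D₀ ^ 2 * ε) * (D - D₀) ^ 2 + 2 * ε * D⁻¹ ^ 2 := by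
  have hDi : 0 ≤ D⁻¹ := inv_nonneg.mpr hD
  have e1 : (16 * t ^ 2 + 2) / (D₀ ^ 2 * ε) =
      4 / D₀ ^ 2 * ((4 * t ^ 2) / ε + 1 / (2 * ε)) := by field_simp; ring
  have e2 : 4 * t ^ 2 ≤ 4 * t ^ 2 / ε := by
    rw [le_div_iff₀ hε]; nlinarith [sq_nonneg t]
  have e3 : 0 ≤ 1 / (2 * ε) := by positivity
  rcases le_or_gt (D₀ / 2) D with h | h
  · have hDpos : 0 < D := by linarith
    have h1 : (D⁻¹ * ν - t) ^ 2 = D⁻¹ ^ 2 * (ν - t * D) ^ 2 := by field_simp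
    have h2 : D⁻¹ ^ 2 ≤ 4 / D₀ ^ 2 := by
      rw [inv_pow, inv_le_comm₀ (by positivity) (by positivity), inv_div]
      nlinarith
    have h3 : (ν - t * D) ^ 2 ≤ 2 * (ν - t * D₀) ^ 2 + 2 * t ^ 2 * (D - D₀) ^ 2 := by
      have := sq_nonneg ((ν - t * D₀) + t * (D - D₀))
      nlinarith
    rw [h1, e1]
    calc D⁻¹ ^ 2 * (ν - t * D) ^ 2
        ≤ 4 / D₀ ^ 2 * (2 * (ν - t * D₀) ^ 2 + 2 * t ^ 2 * (D - D₀) ^ 2) := by gcongr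
      _ ≤ 4 / D₀ ^ 2 * (2 * (ν - t * D₀) ^ 2 + (4 * t ^ 2 / ε + 1 / (2 * ε)) * (D - D₀) ^ 2) := by
        gcongr
        nlinarith [sq_nonneg t]
      _ ≤ _ := by
        have : 0 ≤ 2 * ε * D⁻¹ ^ 2 := by positivity
        have e : 8 / D₀ ^ 2 = 4 / D₀ ^ 2 * 2 := by ring
        rw [e]
        nlinarith
  · have h1 : 1 ≤ 4 / D₀ ^ 2 * (D - D₀) ^ 2 := by
      have : 1 = 4 / D₀ ^ 2 * (D₀ / 2) ^ 2 := by field_simp; norm_num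
      nth_rewrite 1 [this]
      have : (D₀ / 2) ^ 2 ≤ (D - D₀) ^ 2 := by nlinarith
      gcongr
    have h2 : (D⁻¹ * ν) ^ 2 ≤ D⁻¹ := by
      rw [mul_pow]
      calc D⁻¹ ^ 2 * ν ^ 2 ≤ D⁻¹ ^ 2 * D := by gcongr
        _ ≤ D⁻¹ := by
          rcases hD.eq_or_lt with h0 | h0
          · simp [← h0]
          · field_simp; exact le_rfl
    have h3 : D⁻¹ ≤ ε * D⁻¹ ^ 2 + 1 / (4 * ε) := by
      have h4 := sq_nonneg (2 * ε * D⁻¹ - 1)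
      have h5 : ε * D⁻¹ ^ 2 + 1 / (4 * ε) - D⁻¹ = (2 * ε * D⁻¹ - 1) ^ 2 / (4 * ε) := by
        field_simp; ring
      have h6 : 0 ≤ (2 * ε * D⁻¹ - 1) ^ 2 / (4 * ε) := by positivity
      linarith
    have h4 : (D⁻¹ * ν - t) ^ 2 ≤ 2 * (D⁻¹ * ν) ^ 2 + 2 * t ^ 2 := by
      nlinarith [sq_nonneg (D⁻¹ * ν + t)]
    have h5 : 0 ≤ 8 / D₀ ^ 2 * (ν - t * D₀) ^ 2 := by positivity
    have h6 : 1 / (4 * ε) * 2 = 1 / (2 * ε) := by field_simp; norm_num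
    have h7 : 4 * t ^ 2 / ε + 1 / (2 * ε) ≤
        (4 * t ^ 2 / ε + 1 / (2 * ε)) * (4 / D₀ ^ 2 * (D - D₀) ^ 2) :=
      le_mul_of_one_le_right (by positivity) h1
    have h8 : (16 * t ^ 2 + 2) / (D₀ ^ 2 * ε) * (D - D₀) ^ 2 =
        (4 * t ^ 2 / ε + 1 / (2 * ε)) * (4 / D₀ ^ 2 * (D - D₀) ^ 2) := by rw [e1]; ring
    rw [h8]
    nlinarith [sq_nonneg t]

section Entry

variable {ι n : Type*} [Fintype ι] [DecidableEq ι] [Fintype n] [DecidableEq n]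

lemma sq_ratio_sub_le {Q : Matrix n n ℝ} (hQ : Qᵀ = Q) (hQQ : Q * Q = Q) {u z a : n → ℝ}
    (hz : z ⬝ᵥ z = 1) {σ h k s t ε : ℝ} (hD₀ : 0 < k * (σ ^ 2 + h))
    (ht : t * (k * (σ ^ 2 + h)) = k * σ * s) (hε : 0 < ε) (hε1 : ε ≤ 1) :
    (((σ • u + a) ⬝ᵥ (Q *ᵥ (σ • u + a)))⁻¹ * ((σ • u + a) ⬝ᵥ (Q *ᵥ z)) - t) ^ 2 ≤
      8 / (k * (σ ^ 2 + h)) ^ 2 * (2 * σ ^ 2 * (u ⬝ᵥ (Q *ᵥ z) - k * s) ^ 2 +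
        2 * (a ⬝ᵥ (Q *ᵥ z)) ^ 2) +
      (16 * t ^ 2 + 2) / ((k * (σ ^ 2 + h)) ^ 2 * ε) *
        (3 * σ ^ 4 * (u ⬝ᵥ (Q *ᵥ u) - k) ^ 2 + 12 * σ ^ 2 * (a ⬝ᵥ (Q *ᵥ u)) ^ 2 +
          3 * (a ⬝ᵥ (Q *ᵥ a) - k * h) ^ 2) +
      2 * ε * ((σ • u + a) ⬝ᵥ (Q *ᵥ (σ • u + a)))⁻¹ ^ 2 := by
  set y := σ • u + a with hy
  have hD : 0 ≤ y ⬝ᵥ (Q *ᵥ y) := dotProduct_mulVec_projection_nonneg hQ hQQ y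
  have hν : (y ⬝ᵥ (Q *ᵥ z)) ^ 2 ≤ y ⬝ᵥ (Q *ᵥ y) := by
    rw [← dotProduct_mulVec_symm hQ, ← dotProduct_mulVec_projection hQ hQQ]
    have := Finset.sum_mul_sq_le_sq_mul_sq Finset.univ (Q *ᵥ y) z
    have hz' : ∑ i, z i ^ 2 = 1 := by simpa [dotProduct, sq] using hz
    rw [hz', mul_one] at this
    simpa [dotProduct, sq] using this
  refine (sq_inv_mul_sub_le (t := t) hD hν hD₀ hε hε1).trans ?_
  have e1 : y ⬝ᵥ (Q *ᵥ z) - t * (k * (σ ^ 2 + h)) =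
      σ * (u ⬝ᵥ (Q *ᵥ z) - k * s) + a ⬝ᵥ (Q *ᵥ z) := by
    rw [ht, hy, add_dotProduct, smul_dotProduct, smul_eq_mul]; ring
  have e2 : y ⬝ᵥ (Q *ᵥ y) - k * (σ ^ 2 + h) =
      σ ^ 2 * (u ⬝ᵥ (Q *ᵥ u) - k) + 2 * σ * (a ⬝ᵥ (Q *ᵥ u)) + (a ⬝ᵥ (Q *ᵥ a) - k * h) := by
    have : u ⬝ᵥ (Q *ᵥ a) = a ⬝ᵥ (Q *ᵥ u) := by
      rw [← dotProduct_mulVec_symm hQ, dotProduct_comm]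
    simp only [hy, mulVec_add, mulVec_smul, add_dotProduct, dotProduct_add, smul_dotProduct,
      dotProduct_smul, smul_eq_mul, this]
    ring
  rw [e1, e2]
  gcongr ?_ * ?_ + ?_ * ?_ + _
  · nlinarith [sq_nonneg (σ * (u ⬝ᵥ (Q *ᵥ z) - k * s) - a ⬝ᵥ (Q *ᵥ z))]
  · set p := σ ^ 2 * (u ⬝ᵥ (Q *ᵥ u) - k)
    set q := 2 * σ * (a ⬝ᵥ (Q *ᵥ u))
    set r := a ⬝ᵥ (Q *ᵥ a) - k * h
    have : 3 * σ ^ 4 * (u ⬝ᵥ (Q *ᵥ u) - k) ^ 2 + 12 * σ ^ 2 * (a ⬝ᵥ (Q *ᵥ u)) ^ 2 + 3 * r ^ 2 =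
      3 * p ^ 2 + 3 * q ^ 2 + 3 * r ^ 2 := by simp only [p, q]; ring
    rw [this]
    nlinarith [sq_nonneg (p - q), sq_nonneg (q - r), sq_nonneg (p - r)]

/-- The bound for the mean square error of one entry of the coefficient matrix. -/
noncomputable def entryBound (σ h k t ε v τ b₁ b₂ : ℝ) : ℝ :=
  8 / (k * (σ ^ 2 + h)) ^ 2 * (2 * σ ^ 2 * b₁ + 2 * v) +
    (16 * t ^ 2 + 2) / ((k * (σ ^ 2 + h)) ^ 2 * ε) *
      (3 * σ ^ 4 * b₂ + 12 * σ ^ 2 * v + 3 * (gaussSqVar * v ^ 2 * τ + (v * τ - k * h) ^ 2)) +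
    2 * ε * (negMomentBound ^ 8 / (v * τ) ^ 2)

lemma meanLE_ratio_gaussVec {v : NNReal} (hv : v ≠ 0) {Q : Matrix n n ℝ} (hQ : Qᵀ = Q)
    (hQQ : Q * Q = Q) (h8 : 8 ≤ Q.trace) {u z : n → ℝ} (hu : u ⬝ᵥ u = 1)
    (hz : z ⬝ᵥ z = 1) {σ h k s t ε : ℝ} (hD₀ : 0 < k * (σ ^ 2 + h))
    (ht : t * (k * (σ ^ 2 + h)) = k * σ * s) (hε : 0 < ε) (hε1 : ε ≤ 1) :
    ∫⁻ a, ENNReal.ofReal ((((σ • u + a) ⬝ᵥ (Q *ᵥ (σ • u + a)))⁻¹ *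
        ((σ • u + a) ⬝ᵥ (Q *ᵥ z)) - t) ^ 2) ∂(gaussVec n v) ≤
      ENNReal.ofReal (entryBound σ h k t ε v Q.trace ((u ⬝ᵥ (Q *ᵥ z) - k * s) ^ 2)
        ((u ⬝ᵥ (Q *ᵥ u) - k) ^ 2)) := by
  have hlin : ∀ x : n → ℝ, x ⬝ᵥ x = 1 →
      MeanLE (gaussVec n v) (fun a => (a ⬝ᵥ (Q *ᵥ x)) ^ 2) v := by
    intro x hx
    refine ⟨v.2, by simp only [dotProduct]; fun_prop, ?_⟩
    rw [lintegral_dotProduct_sq]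
    refine ENNReal.ofReal_le_ofReal ?_
    have := dotProduct_mulVec_projection_le hQ hQQ x
    rw [dotProduct_mulVec_projection hQ hQQ]
    nlinarith [v.2, this]
  have hmq : ∀ c : n → ℝ, Measurable fun a : n → ℝ => (c + a) ⬝ᵥ (Q *ᵥ (c + a)) := fun c =>
    measurable_dotProduct_mulVec (by fun_prop) (by fun_prop) fun _ _ => measurable_const
  have hquad : MeanLE (gaussVec n v) (fun a => (a ⬝ᵥ (Q *ᵥ a) - k * h) ^ 2)
      (gaussSqVar * v ^ 2 * Q.trace + (v * Q.trace - k * h) ^ 2) := by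
    have := gaussSqVar_nonneg
    refine ⟨by positivity, by have := hmq 0; simp only [zero_add] at this; fun_prop, ?_⟩
    rw [lintegral_quadraticForm_sub_sq v hQ, hQQ]
  have hinv : MeanLE (gaussVec n v) (fun a => ((σ • u + a) ⬝ᵥ (Q *ᵥ (σ • u + a)))⁻¹ ^ 2)
      (negMomentBound ^ 8 / (v * Q.trace) ^ 2) :=
    ⟨by positivity, by have := hmq (σ • u); fun_prop,
      lintegral_projection_inv_sq_le hv hQ hQQ h8 _⟩
  have hb := ((((meanLE_const (μ := gaussVec n v)
    (c := 2 * σ ^ 2 * (u ⬝ᵥ (Q *ᵥ z) - k * s) ^ 2) (by positivity)).add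
    ((hlin z hz).const_mul (c := 2) (by norm_num))).const_mul
      (c := 8 / (k * (σ ^ 2 + h)) ^ 2) (by positivity)).add
    ((((meanLE_const (μ := gaussVec n v)
      (c := 3 * σ ^ 4 * (u ⬝ᵥ (Q *ᵥ u) - k) ^ 2) (by positivity)).add
      ((hlin u hu).const_mul (c := 12 * σ ^ 2) (by positivity))).add
      (hquad.const_mul (c := 3) (by norm_num))).const_mul
      (c := (16 * t ^ 2 + 2) / ((k * (σ ^ 2 + h)) ^ 2 * ε)) (by positivity))).add
    (hinv.const_mul (c := 2 * ε) (by positivity))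
  refine le_trans (lintegral_mono fun a => ENNReal.ofReal_le_ofReal ?_) hb.2.2
  exact sq_ratio_sub_le hQ hQQ hz hD₀ ht hε hε1

lemma lintegral_ratio_le {v : NNReal} (hv : v ≠ 0) (m : ι → n → ℝ) (i : ι)
    (hcard : Fintype.card ι ≤ Fintype.card n)
    (h8 : (8 : ℝ) ≤ Fintype.card n - Fintype.card ι + 1) {u z : n → ℝ} (hu : u ⬝ᵥ u = 1)
    (hz : z ⬝ᵥ z = 1) {σ h k s t ε : ℝ} (hm : m i = σ • u) (hD₀ : 0 < k * (σ ^ 2 + h))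
    (ht : t * (k * (σ ^ 2 + h)) = k * σ * s) (hε : 0 < ε) (hε1 : ε ≤ 1) {b₁ b₂ : ℝ}
    (hb₁ : 0 ≤ b₁) (hb₂ : 0 ≤ b₂)
    (h₁ : ∫⁻ A, ENNReal.ofReal ((u ⬝ᵥ (complProj (m + A) i *ᵥ z) - k * s) ^ 2)
      ∂(Measure.pi fun _ : ι => gaussVec n v) ≤ ENNReal.ofReal b₁)
    (h₂ : ∫⁻ A, ENNReal.ofReal ((u ⬝ᵥ (complProj (m + A) i *ᵥ u) - k) ^ 2)
      ∂(Measure.pi fun _ : ι => gaussVec n v) ≤ ENNReal.ofReal b₂) :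
    ∫⁻ A, ENNReal.ofReal ((((m + A) i ⬝ᵥ (complProj (m + A) i *ᵥ (m + A) i))⁻¹ *
        ((m + A) i ⬝ᵥ (complProj (m + A) i *ᵥ z)) - t) ^ 2)
        ∂(Measure.pi fun _ : ι => gaussVec n v) ≤
      ENNReal.ofReal (entryBound σ h k t ε v (Fintype.card n - Fintype.card ι + 1) b₁ b₂) := by
  set τ : ℝ := Fintype.card n - Fintype.card ι + 1 with hτ
  have hyi : Measurable fun A : ι → n → ℝ => (m + A) i := by
    simp only [Pi.add_apply]; fun_prop
  have hmeas : ∀ {f g : (ι → n → ℝ) → n → ℝ}, Measurable f → Measurable g →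
      Measurable fun A => f A ⬝ᵥ (complProj (m + A) i *ᵥ g A) := fun hf hg =>
    measurable_dotProduct_mulVec hf hg (measurable_complProj_apply m i)
  rw [lintegral_pi_update (fun _ : ι => gaussVec n v) (f := fun A => ENNReal.ofReal
    ((((m + A) i ⬝ᵥ (complProj (m + A) i *ᵥ (m + A) i))⁻¹ *
        ((m + A) i ⬝ᵥ (complProj (m + A) i *ᵥ z)) - t) ^ 2)) (by
      have h1 := hmeas hyi hyi
      have h2 := hmeas hyi (measurable_const (a := z))
      fun_prop) i]
  have hB₁ : MeanLE (Measure.pi fun _ : ι => gaussVec n v)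
      (fun A => (u ⬝ᵥ (complProj (m + A) i *ᵥ z) - k * s) ^ 2) b₁ :=
    ⟨hb₁, by have := hmeas (measurable_const (a := u)) (measurable_const (a := z)); fun_prop, h₁⟩
  have hB₂ : MeanLE (Measure.pi fun _ : ι => gaussVec n v)
      (fun A => (u ⬝ᵥ (complProj (m + A) i *ᵥ u) - k) ^ 2) b₂ :=
    ⟨hb₂, by have := hmeas (measurable_const (a := u)) (measurable_const (a := u)); fun_prop, h₂⟩
  have hg := gaussSqVar_nonneg
  have hv0 : (0 : ℝ) ≤ v := v.2
  have hτ0 : 0 ≤ τ := by linarith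
  have hb := ((((hB₁.const_mul (c := 2 * σ ^ 2) (by positivity)).add
    (meanLE_const (c := 2 * (v : ℝ)) (by positivity))).const_mul
      (c := 8 / (k * (σ ^ 2 + h)) ^ 2) (by positivity)).add
    ((((hB₂.const_mul (c := 3 * σ ^ 4) (by positivity)).add
      (meanLE_const (c := 12 * σ ^ 2 * (v : ℝ)) (by positivity))).add
      (meanLE_const (c := 3 * (gaussSqVar * v ^ 2 * τ + (v * τ - k * h) ^ 2))
        (by positivity))).const_mul
      (c := (16 * t ^ 2 + 2) / ((k * (σ ^ 2 + h)) ^ 2 * ε)) (by positivity))).add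
    (meanLE_const (c := 2 * ε * (negMomentBound ^ 8 / (v * τ) ^ 2)) (by positivity))
  refine le_trans (lintegral_mono_ae ?_) hb.2.2
  filter_upwards [ae_linearIndependent hv hcard m] with A hA
  have hupd : ∀ a, complProj (m + Function.update A i a) i = complProj (m + A) i := fun a =>
    complProj_congr fun j hj => by simp [Function.update_of_ne hj]
  have hupi : ∀ a, (m + Function.update A i a) i = σ • u + a := fun a => by
    simp [hm]
  simp_rw [hupd, hupi]
  have htr := trace_complProj hA i
  have := meanLE_ratio_gaussVec hv (transpose_complProj (m + A) i) (complProj_mul_self (m + A) i)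
    (by rw [htr]; exact h8) hu hz hD₀ ht hε hε1
  rw [htr] at this
  exact this

end Entry

section LeaveOut

variable {n ρ : Type*} [Fintype n] [DecidableEq n] [Fintype ρ] [DecidableEq ρ]

/-- The orthogonal projection onto the complement of the columns of `U` other than the `p`-th. -/
noncomputable def leaveOut (U : Matrix n ρ ℝ) (p : ρ) : Matrix n n ℝ :=
  1 - U * (diagonal (fun j => if j = p then (0 : ℝ) else 1) * Uᵀ)

lemma transpose_leaveOut (U : Matrix n ρ ℝ) (p : ρ) : (leaveOut U p)ᵀ = leaveOut U p := by
  simp [leaveOut, Matrix.mul_assoc]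

variable {U : Matrix n ρ ℝ} (hU : Uᵀ * U = 1)

include hU

lemma leaveOut_mul_self (p : ρ) : leaveOut U p * leaveOut U p = leaveOut U p := by
  set D : Matrix ρ ρ ℝ := diagonal (fun j => if j = p then 0 else 1) with hD
  have hDD : D * D = D := by
    rw [hD, diagonal_mul_diagonal]; congr 1; ext j; split_ifs <;> simp
  have h : U * (D * Uᵀ) * (U * (D * Uᵀ)) = U * (D * Uᵀ) := by
    calc U * (D * Uᵀ) * (U * (D * Uᵀ)) = U * (D * ((Uᵀ * U) * (D * Uᵀ))) := by
          simp only [Matrix.mul_assoc]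
      _ = _ := by rw [hU, Matrix.one_mul, ← Matrix.mul_assoc D, hDD]
  rw [leaveOut, ← hD, sub_mul, one_mul, mul_sub, mul_one, h]
  simp

lemma trace_leaveOut (p : ρ) :
    (leaveOut U p).trace = Fintype.card n - (Fintype.card ρ - 1) := by
  rw [leaveOut, trace_sub, trace_one, trace_mul_comm, Matrix.mul_assoc, hU, Matrix.mul_one,
    trace_diagonal]
  have : ∀ j, (if j = p then (0 : ℝ) else 1) = 1 - if j = p then 1 else 0 := fun j => by
    split_ifs <;> simp
  simp_rw [this]
  simp [Finset.sum_sub_distrib]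

lemma leaveOut_mulVec_col (p q : ρ) :
    leaveOut U p *ᵥ U.col q = if q = p then U.col q else 0 := by
  have h : leaveOut U p * U = U * diagonal (fun j => if j = p then (1 : ℝ) else 0) := by
    rw [leaveOut, Matrix.sub_mul, Matrix.one_mul, Matrix.mul_assoc, Matrix.mul_assoc, hU,
      Matrix.mul_one]
    nth_rewrite 1 [← Matrix.mul_one U]
    rw [← Matrix.mul_sub, ← diagonal_one, diagonal_sub]
    congr 2; ext j; split_ifs <;> simp
  ext l
  have := congrFun (congrFun h l) q
  rw [mul_diagonal] at this
  change (leaveOut U p * U) l q = _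
  rw [this]
  split_ifs <;> simp

lemma col_dotProduct_col (p : ρ) : U.col p ⬝ᵥ U.col p = 1 := by
  have := congrFun (congrFun hU p) p
  simpa [mul_apply, dotProduct] using this

end LeaveOut

section PinvEntry

variable {ι n ρ : Type*} [Fintype ι] [DecidableEq ι] [Fintype n] [DecidableEq n]
  [Fintype ρ] [DecidableEq ρ]

/-- The bound for the mean square fluctuation of a leave-one-out quadratic form. -/
noncomputable def quadBound (k d θ τ : ℝ) : ℝ :=
  (2 * gaussSqVar * θ + (|τ - k * d| + (d - θ)) ^ 2) / θ ^ 2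

lemma lintegral_pinv_entry_le {v : NNReal} (hv : v ≠ 0) {U : Matrix n ρ ℝ} (hU : Uᵀ * U = 1)
    {e : ρ → ι} {σ : ρ → ℝ} {m : ι → n → ℝ}
    (hm : ∀ p, m (e p) = σ p • U.col p) (hm0 : ∀ j, (∀ p, j ≠ e p) → m j = 0)
    (hcard : Fintype.card ι ≤ Fintype.card n)
    (h8 : (8 : ℝ) ≤ Fintype.card n - Fintype.card ι + 1)
    (hθ : (0 : ℝ) < Fintype.card n - (Fintype.card ρ - 1))
    {h k ε : ℝ} (hh : 0 < h) (hk0 : 0 < k) (hk1 : k ≤ 1) (hε : 0 < ε) (hε1 : ε ≤ 1) (p q : ρ) :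
    ∫⁻ A, ENNReal.ofReal ((((((colsMat (m + A))ᵀ * colsMat (m + A))⁻¹ * (colsMat (m + A))ᵀ) *ᵥ
        U.col q) (e p) - diagonal (fun i => σ i / (σ i ^ 2 + h)) p q) ^ 2)
        ∂(Measure.pi fun _ : ι => gaussVec n v) ≤
      ENNReal.ofReal (entryBound (σ p) h k (diagonal (fun i => σ i / (σ i ^ 2 + h)) p q) ε v
        (Fintype.card n - Fintype.card ι + 1)
        (1 / (Fintype.card n - (Fintype.card ρ - 1) : ℝ) +
          quadBound k (Fintype.card n) (Fintype.card n - (Fintype.card ρ - 1))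
            (Fintype.card n - Fintype.card ι + 1))
        (quadBound k (Fintype.card n) (Fintype.card n - (Fintype.card ρ - 1))
            (Fintype.card n - Fintype.card ι + 1))) := by
  set b₂ := quadBound k (Fintype.card n) (Fintype.card n - (Fintype.card ρ - 1))
            (Fintype.card n - Fintype.card ι + 1) with hb₂
  have htr := trace_leaveOut hU p
  have hPm : ∀ j ≠ e p, leaveOut U p *ᵥ m j = 0 := by
    intro j hj
    by_cases hje : ∃ p', j = e p'
    · obtain ⟨p', rfl⟩ := hje
      have : p' ≠ p := fun h => hj (by rw [h])
      rw [hm, mulVec_smul, leaveOut_mulVec_col hU, if_neg this, smul_zero]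
    · push Not at hje
      rw [hm0 j hje, mulVec_zero]
  have hPu : leaveOut U p *ᵥ U.col p = U.col p := by rw [leaveOut_mulVec_col hU, if_pos rfl]
  have hg := gaussSqVar_nonneg
  have hb₂0 : 0 ≤ b₂ := by rw [hb₂, quadBound]; positivity
  have hθ1 : (0 : ℝ) ≤ 1 / (Fintype.card n - (Fintype.card ρ - 1) : ℝ) := by positivity
  have h₂ := lintegral_quadraticForm_complProj_le v m (e p) (transpose_leaveOut U p)
    (leaveOut_mul_self hU p) hPm (col_dotProduct_col hU p) hPu hv hcard (by rw [htr]; exact hθ)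
    hk0.le hk1
  rw [htr, ← quadBound, ← hb₂] at h₂
  have h₁ : ∫⁻ A, ENNReal.ofReal ((U.col p ⬝ᵥ (complProj (m + A) (e p) *ᵥ U.col q) -
      k * (1 : Matrix ρ ρ ℝ) p q) ^ 2) ∂(Measure.pi fun _ : ι => gaussVec n v) ≤
      ENNReal.ofReal (1 / (Fintype.card n - (Fintype.card ρ - 1) : ℝ) + b₂) := by
    by_cases hpq : p = q
    · subst hpq
      simp only [one_apply_eq, mul_one]
      exact h₂.trans (ENNReal.ofReal_le_ofReal (by linarith))
    · have := lintegral_bilinForm_complProj_le v m (e p) (transpose_leaveOut U p)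
        (leaveOut_mul_self hU p) hPm (col_dotProduct_col hU p) hPu (by rw [htr]; exact hθ)
        (col_dotProduct_col hU q)
        (by rw [leaveOut_mulVec_col hU, if_neg (Ne.symm hpq)])
      rw [htr] at this
      simp only [one_apply_ne hpq, mul_zero, sub_zero]
      exact this.trans (ENNReal.ofReal_le_ofReal (by linarith))
  have hD : 0 < σ p ^ 2 + h := by positivity
  refine le_trans (lintegral_mono_ae ?_) (lintegral_ratio_le hv m (e p) hcard h8
    (col_dotProduct_col hU p) (col_dotProduct_col hU q) (hm p) (by positivity)
    (s := (1 : Matrix ρ ρ ℝ) p q) (t := diagonal (fun i => σ i / (σ i ^ 2 + h)) p q) ?_ hε hε1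
    (by positivity) hb₂0 h₁ h₂)
  · filter_upwards [ae_linearIndependent hv hcard m] with A hA
    rw [gram_inv_mul_transpose_mulVec hA]
  · by_cases hpq : p = q
    · subst hpq
      simp only [diagonal_apply_eq, one_apply_eq, mul_one]
      field_simp
    · simp [diagonal_apply_ne _ hpq, one_apply_ne hpq]

end PinvEntry

lemma exists_orthogonal_extension {ι ρ : Type*} [Fintype ι] [DecidableEq ι] [Fintype ρ]
    [DecidableEq ρ] {V : Matrix ι ρ ℝ} (hV : Vᵀ * V = 1) {e : ρ → ι} (he : Function.Injective e) :
    ∃ O : Matrix ι ι ℝ, Oᵀ * O = 1 ∧ ∀ l p, O l (e p) = V l p := by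
  have hinner : ∀ x y : EuclideanSpace ℝ ι, inner ℝ x y = ∑ l, x l * y l := fun x y => by
    simp [PiLp.inner_apply, mul_comm]
  set w : ι → EuclideanSpace ℝ ι :=
    Function.extend e (fun p => WithLp.toLp 2 (V.col p)) 0 with hw
  have hwe : ∀ p, w (e p) = WithLp.toLp 2 (V.col p) := fun p => he.extend_apply _ _ p
  have horth : Orthonormal ℝ ((Set.range e).domRestrict w) := by
    rw [orthonormal_iff_ite]
    rintro ⟨_, p, rfl⟩ ⟨_, q, rfl⟩
    have := congrFun (congrFun hV p) q
    simp only [mul_apply, transpose_apply] at this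
    change inner ℝ (w (e p)) (w (e q)) = _
    rw [hwe, hwe, hinner]
    have hpq : (⟨e p, p, rfl⟩ : Set.range e) = ⟨e q, q, rfl⟩ ↔ p = q :=
      Subtype.ext_iff.trans he.eq_iff
    simp [this, one_apply, hpq]
  obtain ⟨b, hb⟩ := horth.exists_orthonormalBasis_extension_of_card_eq (by simp)
  refine ⟨of fun l j => b j l, ?_, fun l p => ?_⟩
  · ext i j
    have := orthonormal_iff_ite.mp b.orthonormal i j
    rw [hinner] at this
    simpa [mul_apply, one_apply] using this
  · simp [hb (e p) ⟨p, rfl⟩, hwe]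

/-- The coefficient matrix `Vᵀ (Yᵀ Y)⁻¹ Yᵀ U` of the pseudoinverse of `Y`. -/
noncomputable def pinvCoeff {d N r : ℕ} (U : Matrix (Fin d) (Fin r) ℝ)
    (V : Matrix (Fin N) (Fin r) ℝ) (Y : Matrix (Fin d) (Fin N) ℝ) : Matrix (Fin r) (Fin r) ℝ :=
  Vᵀ * (((Yᵀ * Y)⁻¹ * Yᵀ) * U)

section Transport

variable {d N r : ℕ} {U : Matrix (Fin d) (Fin r) ℝ} {V : Matrix (Fin N) (Fin r) ℝ}

lemma measurable_pinvCoeff_apply (X : Matrix (Fin d) (Fin N) ℝ) (p q : Fin r) :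
    Measurable fun A : Matrix (Fin d) (Fin N) ℝ => pinvCoeff U V (X + A) p q := by
  simp only [pinvCoeff, mul_apply (M := Vᵀ), mul_apply (N := U)]
  have hc : Continuous fun A : Fin d → Fin N → ℝ => X + of A := continuous_const.add continuous_id
  refine Finset.measurable_sum _ fun j _ => measurable_const.mul ?_
  exact Finset.measurable_sum _ fun l _ =>
    (measurable_gram_inv_mul_transpose_apply hc j l).mul measurable_const

lemma pinvCoeff_eq {O : Matrix (Fin N) (Fin N) ℝ} (hO : Oᵀ * O = 1) {e : Fin r → Fin N}
    (hOV : ∀ l p, O l (e p) = V l p) (Y : Matrix (Fin d) (Fin N) ℝ) (p q : Fin r) :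
    pinvCoeff U V Y p q = ((((Y * O)ᵀ * (Y * O))⁻¹ * (Y * O)ᵀ) *ᵥ U.col q) (e p) := by
  have hO' : O * Oᵀ = 1 := mul_eq_one_comm.mp hO
  have h1 : ((Y * O)ᵀ * (Y * O))⁻¹ * (Y * O)ᵀ = Oᵀ * ((Yᵀ * Y)⁻¹ * Yᵀ) := by
    have hi : O⁻¹ = Oᵀ := inv_eq_left_inv hO
    have hi' : (Oᵀ)⁻¹ = O := inv_eq_left_inv hO'
    have : (Y * O)ᵀ * (Y * O) = Oᵀ * (Yᵀ * Y) * O := by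
      rw [transpose_mul]; simp only [Matrix.mul_assoc]
    rw [this, Matrix.mul_inv_rev, Matrix.mul_inv_rev, hi, hi', transpose_mul]
    calc Oᵀ * ((Yᵀ * Y)⁻¹ * O) * (Oᵀ * Yᵀ) = Oᵀ * ((Yᵀ * Y)⁻¹ * ((O * Oᵀ) * Yᵀ)) := by
          simp only [Matrix.mul_assoc]
      _ = _ := by rw [hO', Matrix.one_mul]
  rw [h1, ← mulVec_mulVec, pinvCoeff, mul_apply]
  simp only [mulVec, dotProduct, transpose_apply, hOV]
  refine Finset.sum_congr rfl fun l _ => ?_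
  rw [mul_apply]
  rfl

lemma lintegral_pinvCoeff_sub_sq_le (hU : Uᵀ * U = 1) (hV : Vᵀ * V = 1) {v : NNReal} (hv : v ≠ 0)
    {σ : Fin r → ℝ} (hrN : r ≤ N) (hNd : N ≤ d) (h8 : (8 : ℝ) ≤ d - N + 1)
    (hθ : (0 : ℝ) < d - (r - 1)) {h k ε : ℝ} (hh : 0 < h) (hk0 : 0 < k) (hk1 : k ≤ 1)
    (hε : 0 < ε) (hε1 : ε ≤ 1) (p q : Fin r) :
    ∫⁻ A, ENNReal.ofReal ((pinvCoeff U V (U * diagonal σ * Vᵀ + A) p q -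
        diagonal (fun i => σ i / (σ i ^ 2 + h)) p q) ^ 2) ∂(gaussMatrix d N v) ≤
      ENNReal.ofReal (entryBound (σ p) h k (diagonal (fun i => σ i / (σ i ^ 2 + h)) p q) ε v
        (d - N + 1) (1 / (d - (r - 1)) + quadBound k d (d - (r - 1)) (d - N + 1))
        (quadBound k d (d - (r - 1)) (d - N + 1))) := by
  obtain ⟨O, hO, hOV⟩ := exists_orthogonal_extension hV (Fin.castLE_injective hrN)
  set X := U * diagonal σ * Vᵀ with hX
  have hVO : ∀ p j, (Vᵀ * O) p j = if Fin.castLE hrN p = j then 1 else 0 := by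
    intro p j
    rw [← one_apply, ← hO, mul_apply, mul_apply]
    exact Finset.sum_congr rfl fun l _ => by rw [transpose_apply, transpose_apply, hOV]
  set m : Fin N → Fin d → ℝ := fun j l => (X * O) l j with hm
  have hXO : ∀ l j, (X * O) l j = ∑ p, U l p * σ p * if Fin.castLE hrN p = j then 1 else 0 := by
    intro l j
    rw [hX, Matrix.mul_assoc, mul_apply]
    exact Finset.sum_congr rfl fun p _ => by rw [mul_diagonal, hVO]
  have key := lintegral_pinv_entry_le hv hU (e := Fin.castLE hrN) (σ := σ) (m := m)
    (fun p => by
      ext l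
      simp [hm, hXO, (Fin.castLE_injective hrN).eq_iff, mul_comm])
    (fun j hj => by
      ext l
      simp only [hm, hXO, Pi.zero_apply]
      exact Finset.sum_eq_zero fun p _ => by rw [if_neg (fun h => hj p h.symm), mul_zero])
    (by simpa using hNd) (by simpa using h8) (by simpa using hθ) hh hk0 hk1 hε hε1 p q
  simp only [Fintype.card_fin] at key
  refine le_trans (le_of_eq ?_) key
  have hmp := measurePreserving_columns (n := Fin d) v hO
  have hmeas : Measurable fun A : Fin N → Fin d → ℝ =>
      ENNReal.ofReal ((((((colsMat (m + A))ᵀ * colsMat (m + A))⁻¹ * (colsMat (m + A))ᵀ) *ᵥ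
        U.col q) (Fin.castLE hrN p) - diagonal (fun i => σ i / (σ i ^ 2 + h)) p q) ^ 2) := by
    have hc : Continuous fun A : Fin N → Fin d → ℝ => colsMat (m + A) :=
      continuous_matrix fun l j => by simp only [colsMat, Pi.add_apply]; fun_prop
    have : Measurable fun A : Fin N → Fin d → ℝ =>
        ((((colsMat (m + A))ᵀ * colsMat (m + A))⁻¹ * (colsMat (m + A))ᵀ) *ᵥ
        U.col q) (Fin.castLE hrN p) := by
      simp only [mulVec, dotProduct]
      exact Finset.measurable_sum _ fun l _ =>
        (measurable_gram_inv_mul_transpose_apply hc _ l).mul measurable_const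
    fun_prop
  rw [← hmp.lintegral_comp hmeas]
  refine lintegral_congr fun A => ?_
  rw [pinvCoeff_eq hO hOV]
  have hcol : colsMat (m + fun (j : Fin N) (l : Fin d) => ∑ k, A l k * O k j) = (X + A) * O := by
    rw [Matrix.add_mul]
    rfl
  rw [hcol]

end Transport

section Limits

lemma tendsto_entryBound {v τ b₁ b₂ : ℕ → ℝ} {h k : ℝ} (hkh : k * h ≠ 0) (σ t ε : ℝ)
    (hv : Tendsto v atTop (nhds 0)) (hvτ : Tendsto (fun N => v N * τ N) atTop (nhds (k * h)))
    (hb₁ : Tendsto b₁ atTop (nhds 0)) (hb₂ : Tendsto b₂ atTop (nhds 0)) :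
    Tendsto (fun N => entryBound σ h k t ε (v N) (τ N) (b₁ N) (b₂ N)) atTop
      (nhds (2 * ε * (negMomentBound ^ 8 / (k * h) ^ 2))) := by
  have e : ∀ N, entryBound σ h k t ε (v N) (τ N) (b₁ N) (b₂ N) =
      8 / (k * (σ ^ 2 + h)) ^ 2 * (2 * σ ^ 2 * b₁ N + 2 * v N) +
      (16 * t ^ 2 + 2) / ((k * (σ ^ 2 + h)) ^ 2 * ε) *
        (3 * σ ^ 4 * b₂ N + 12 * σ ^ 2 * v N +
          3 * (gaussSqVar * (v N * (v N * τ N)) + (v N * τ N - k * h) ^ 2)) +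
      2 * ε * (negMomentBound ^ 8 / (v N * τ N) ^ 2) := fun N => by rw [entryBound]; ring
  simp_rw [e]
  have h1 := ((hb₁.const_mul (2 * σ ^ 2)).add (hv.const_mul 2)).const_mul
    (8 / (k * (σ ^ 2 + h)) ^ 2)
  have h2 := (((hb₂.const_mul (3 * σ ^ 4)).add (hv.const_mul (12 * σ ^ 2))).add
    ((((hv.mul hvτ).const_mul gaussSqVar).add ((hvτ.sub_const (k * h)).pow 2)).const_mul 3)).const_mul
    ((16 * t ^ 2 + 2) / ((k * (σ ^ 2 + h)) ^ 2 * ε))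
  have h3 := ((tendsto_const_nhds (x := negMomentBound ^ 8)).div (hvτ.pow 2) (pow_ne_zero 2 hkh)).const_mul (2 * ε)
  have := (h1.add h2).add h3
  simpa only [Pi.div_apply, mul_zero, zero_mul, add_zero, zero_add, sub_self, ne_eq,
    OfNat.ofNat_ne_zero, not_false_eq_true, zero_pow] using! this

variable {c : ℝ} {d : ℕ → ℕ}

lemma tendsto_atTop_of_ratio (hc : 0 < c)
    (hdc : Tendsto (fun N : ℕ => (d N : ℝ) / N) atTop (nhds c)) :
    Tendsto (fun N => (d N : ℝ)) atTop atTop := by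
  have := hdc.pos_mul_atTop hc tendsto_natCast_atTop_atTop
  refine this.congr' ?_
  filter_upwards [eventually_gt_atTop 0] with N hN
  field_simp

lemma tendsto_colRatio (hc : 0 < c)
    (hdc : Tendsto (fun N : ℕ => (d N : ℝ) / N) atTop (nhds c)) :
    Tendsto (fun N => ((d N : ℝ) - N + 1) / d N) atTop (nhds (1 - 1 / c)) := by
  have hd := tendsto_atTop_of_ratio hc hdc
  have h1 : Tendsto (fun N : ℕ => 1 - ((d N : ℝ) / N)⁻¹ + (d N : ℝ)⁻¹) atTop
      (nhds (1 - c⁻¹ + 0)) := ((hdc.inv₀ hc.ne').const_sub 1).add hd.inv_tendsto_atTop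
  rw [add_zero, ← one_div] at h1
  refine h1.congr' ?_
  filter_upwards [hd.eventually_gt_atTop 0] with N hN
  field_simp

lemma tendsto_quadBound {k : ℝ} (r : ℝ) (hd : Tendsto (fun N => (d N : ℝ)) atTop atTop)
    (hτ : Tendsto (fun N => ((d N : ℝ) - N + 1) / d N) atTop (nhds k)) :
    Tendsto (fun N : ℕ => quadBound k (d N) (d N - (r - 1)) (d N - N + 1)) atTop (nhds 0) := by
  have hinv : Tendsto (fun N => (d N : ℝ)⁻¹) atTop (nhds 0) := hd.inv_tendsto_atTop
  have hθ : Tendsto (fun N => 1 - (r - 1) * (d N : ℝ)⁻¹) atTop (nhds 1) := by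
    simpa using (hinv.const_mul (r - 1)).const_sub 1
  have h := (((hθ.mul hinv).const_mul (2 * gaussSqVar)).add
    (((hτ.sub_const k).abs.add (hinv.const_mul (r - 1))).pow 2)).div (hθ.pow 2) (by norm_num)
  have h0 : (2 * gaussSqVar * (1 * 0) + (|k - k| + (r - 1) * 0) ^ 2) / 1 ^ 2 = 0 := by simp
  rw [h0] at h
  refine h.congr' ?_
  filter_upwards [hd.eventually_gt_atTop 0] with N hN
  have e1 : 1 - (r - 1) * (d N : ℝ)⁻¹ = (d N - (r - 1)) / d N := by field_simp
  have e2 : ((d N : ℝ) - N + 1) / d N - k = (d N - N + 1 - k * d N) / d N := by field_simp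
  rw [Pi.div_apply]
  rw [e1, e2, abs_div, abs_of_pos hN, quadBound]
  have e3 : (d N : ℝ) - (d N - (r - 1)) = r - 1 := by ring
  rw [e3]
  field_simp

lemma tendsto_lintegral_pinvCoeff_sub_sq {r : ℕ} {η : ℝ} (hc : 1 < c) (hη : 0 < η)
    (hdc : Tendsto (fun N : ℕ => (d N : ℝ) / N) atTop (nhds c))
    {U : (N : ℕ) → Matrix (Fin (d N)) (Fin r) ℝ} (hU : ∀ N, r ≤ d N → (U N)ᵀ * U N = 1)
    {V : (N : ℕ) → Matrix (Fin N) (Fin r) ℝ} (hV : ∀ N, r ≤ N → (V N)ᵀ * V N = 1)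
    (σ : Fin r → ℝ) (p q : Fin r) :
    Tendsto (fun N : ℕ => ∫⁻ A, ENNReal.ofReal
        ((pinvCoeff (U N) (V N) (U N * diagonal σ * (V N)ᵀ + A) p q -
          diagonal (fun i => σ i / (σ i ^ 2 + η ^ 2)) p q) ^ 2)
        ∂(gaussMatrix (d N) N ((η ^ 2 / (d N : ℝ)).toNNReal))) atTop (nhds 0) := by
  have hc0 : 0 < c := by linarith
  set k := 1 - 1 / c with hk
  have hc1 : 1 / c < 1 := by rw [div_lt_one hc0]; exact hc
  have hk0 : 0 < k := by rw [hk]; linarith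
  have hk1 : k ≤ 1 := by have : 0 < 1 / c := by positivity
                         rw [hk]; linarith
  have hh : 0 < η ^ 2 := by positivity
  have hd := tendsto_atTop_of_ratio hc0 hdc
  have hτ : Tendsto (fun N => ((d N : ℝ) - N + 1) / d N) atTop (nhds k) := tendsto_colRatio hc0 hdc
  have hv : Tendsto (fun N => η ^ 2 / (d N : ℝ)) atTop (nhds 0) := hd.const_div_atTop _
  have hvτ : Tendsto (fun N => η ^ 2 / (d N : ℝ) * ((d N : ℝ) - N + 1)) atTop
      (nhds (k * η ^ 2)) := by
    refine (hτ.mul_const (η ^ 2)).congr fun N => by ring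
  have hθ : Tendsto (fun N => (d N : ℝ) - (r - 1)) atTop atTop :=
    tendsto_atTop_add_const_right _ _ hd
  have hb₂ := tendsto_quadBound (r : ℝ) hd hτ
  have hb₁ : Tendsto (fun N : ℕ => 1 / ((d N : ℝ) - (r - 1)) +
      quadBound k (d N) (d N - (r - 1)) (d N - N + 1)) atTop (nhds 0) := by
    simpa only [add_zero] using (hθ.const_div_atTop 1).add hb₂
  have hτ8 : ∀ᶠ N : ℕ in atTop, (8 : ℝ) ≤ d N - N + 1 := by
    have : Tendsto (fun N => (d N : ℝ) - N + 1) atTop atTop := by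
      refine (hτ.pos_mul_atTop hk0 hd).congr' ?_
      filter_upwards [hd.eventually_gt_atTop 0] with N hN
      field_simp
    exact this.eventually_ge_atTop 8
  have hNd : ∀ᶠ N : ℕ in atTop, N ≤ d N := by
    filter_upwards [hdc.eventually_const_lt hc, eventually_gt_atTop 0] with N hN hN0
    have : (0 : ℝ) < N := by exact_mod_cast hN0
    rw [lt_div_iff₀ this, one_mul] at hN
    exact_mod_cast hN.le
  have hbound : ∀ ε : ℝ, 0 < ε → ε ≤ 1 → ∀ᶠ N : ℕ in atTop, ∫⁻ A, ENNReal.ofReal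
        ((pinvCoeff (U N) (V N) (U N * diagonal σ * (V N)ᵀ + A) p q -
          diagonal (fun i => σ i / (σ i ^ 2 + η ^ 2)) p q) ^ 2)
        ∂(gaussMatrix (d N) N ((η ^ 2 / (d N : ℝ)).toNNReal)) ≤
      ENNReal.ofReal (entryBound (σ p) (η ^ 2) k
        (diagonal (fun i => σ i / (σ i ^ 2 + η ^ 2)) p q) ε (η ^ 2 / (d N : ℝ))
        (d N - N + 1) (1 / (d N - (r - 1)) + quadBound k (d N) (d N - (r - 1)) (d N - N + 1))
        (quadBound k (d N) (d N - (r - 1)) (d N - N + 1))) := by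
    intro ε hε hε1
    filter_upwards [hτ8, hNd, eventually_ge_atTop r, hθ.eventually_gt_atTop 0,
      hd.eventually_gt_atTop 0] with N h8 hN hrN hθN hdN
    have hpos : 0 < η ^ 2 / (d N : ℝ) := by positivity
    have := lintegral_pinvCoeff_sub_sq_le (hU N (hrN.trans hN)) (hV N hrN)
      (v := (η ^ 2 / (d N : ℝ)).toNNReal) (by simpa using hpos) (σ := σ) hrN hN h8 hθN hh hk0 hk1
      hε hε1 p q
    rwa [Real.coe_toNNReal _ hpos.le] at this
  rw [ENNReal.tendsto_nhds_zero]
  intro δ hδ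
  obtain ⟨δ', hδ'0, hδ'⟩ : ∃ δ' : ℝ, 0 < δ' ∧ ENNReal.ofReal δ' ≤ δ := by
    obtain ⟨x, hx0, hx⟩ := ENNReal.lt_iff_exists_nnreal_btwn.mp hδ
    exact ⟨x, by exact_mod_cast hx0, by rw [ENNReal.ofReal_coe_nnreal]; exact hx.le⟩
  set K : ℝ := negMomentBound ^ 8 / (k * η ^ 2) ^ 2 with hK
  have hK0 : 0 ≤ K := by positivity
  set ε := min 1 (δ' / (2 * K + 1)) / 2 with hε
  have hε0 : 0 < ε := by positivity
  have hε1 : ε ≤ 1 := by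
    have := min_le_left 1 (δ' / (2 * K + 1))
    rw [hε]; linarith
  have hlt : 2 * ε * K < δ' := by
    have h1 := min_le_right 1 (δ' / (2 * K + 1))
    have h2 : ε * (2 * K + 1) ≤ δ' / 2 := by
      calc ε * (2 * K + 1) ≤ δ' / (2 * K + 1) / 2 * (2 * K + 1) := by
            gcongr
            rw [hε]; linarith
        _ = δ' / 2 := by field_simp
    nlinarith
  have hlim := tendsto_entryBound (mul_pos hk0 hh).ne' (σ p)
    (diagonal (fun i => σ i / (σ i ^ 2 + η ^ 2)) p q) ε hv hvτ hb₁ hb₂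
  filter_upwards [hbound ε hε0 hε1, hlim.eventually_lt_const hlt] with N h1 h2
  exact h1.trans ((ENNReal.ofReal_le_ofReal h2.le).trans hδ')

end Limits

lemma tendsto_integral_sq {Ω : ℕ → Type*} [∀ N, MeasurableSpace (Ω N)] {μ : ∀ N, Measure (Ω N)}
    [∀ N, IsProbabilityMeasure (μ N)] {f : ∀ N, Ω N → ℝ} (hf : ∀ N, Measurable (f N)) {a : ℝ}
    (h : Tendsto (fun N => ∫⁻ x, ENNReal.ofReal ((f N x - a) ^ 2) ∂(μ N)) atTop (nhds 0)) :
    (∀ᶠ N in atTop, Integrable (fun x => f N x ^ 2) (μ N)) ∧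
      Tendsto (fun N => ∫ x, f N x ^ 2 ∂(μ N)) atTop (nhds (a ^ 2)) := by
  have hg : ∀ N, Measurable fun x => f N x - a := fun N => (hf N).sub_const a
  have hmem : ∀ᶠ N in atTop, MemLp (fun x => f N x - a) 2 (μ N) := by
    filter_upwards [h.eventually_lt_const ENNReal.zero_lt_top] with N hN
    rw [memLp_two_iff_integrable_sq (hg N).aestronglyMeasurable]
    refine ⟨((hg N).pow_const 2).aestronglyMeasurable, ?_⟩
    rwa [hasFiniteIntegral_iff_ofReal (Eventually.of_forall fun x => sq_nonneg _)]
  have hsq : Tendsto (fun N => ∫ x, (f N x - a) ^ 2 ∂(μ N)) atTop (nhds 0) := by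
    have h1 := (ENNReal.tendsto_toReal ENNReal.zero_ne_top).comp h
    refine h1.congr fun N => ?_
    rw [integral_eq_lintegral_of_nonneg_ae (Eventually.of_forall fun x => sq_nonneg _)
      ((hg N).pow_const 2).aestronglyMeasurable]
    rfl
  have hmean : Tendsto (fun N => ∫ x, (f N x - a) ∂(μ N)) atTop (nhds 0) := by
    have : Tendsto (fun N => (∫ x, (f N x - a) ∂(μ N)) ^ 2) atTop (nhds 0) := by
      refine tendsto_of_tendsto_of_tendsto_of_le_of_le' tendsto_const_nhds hsq
        (Eventually.of_forall fun N => sq_nonneg _) ?_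
      filter_upwards [hmem] with N hN
      have h1 := variance_eq_sub hN
      have h2 := variance_nonneg (fun x => f N x - a) (μ N)
      rw [h1] at h2
      simpa using h2
    have h3 := this.sqrt
    simp only [Real.sqrt_sq_eq_abs, Real.sqrt_zero] at h3
    exact (tendsto_zero_iff_abs_tendsto_zero _).mpr h3
  have hexp : ∀ N, (fun x => f N x ^ 2) =
      fun x => (f N x - a) ^ 2 + 2 * a * (f N x - a) + a ^ 2 := fun N => by ext x; ring
  constructor
  · filter_upwards [hmem] with N hN
    rw [hexp]
    exact (hN.integrable_sq.add ((hN.integrable (by norm_num)).const_mul _)).add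
      (integrable_const _)
  · have h1 := (hsq.add (hmean.const_mul (2 * a))).add_const (a ^ 2)
    simp only [mul_zero, add_zero, zero_add] at h1
    refine h1.congr' ?_
    filter_upwards [hmem] with N hN
    have i1 := hN.integrable_sq
    have i2 : Integrable (fun x => 2 * a * (f N x - a)) (μ N) :=
      (hN.integrable (by norm_num)).const_mul _
    have i3 : Integrable (fun x => (f N x - a) ^ 2 + 2 * a * (f N x - a)) (μ N) := i1.add i2
    rw [hexp, integral_add i3 (integrable_const _), integral_add i1 i2, integral_const_mul]
    simp

instance (d N : ℕ) (v : NNReal) : IsProbabilityMeasure (gaussMatrix d N v) :=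
  inferInstanceAs (IsProbabilityMeasure
    (Measure.pi fun _ : Fin d => Measure.pi fun _ : Fin N => gaussianReal 0 v))

lemma frobSq_mul_of_transpose_mul_self {d r n : ℕ} {U : Matrix (Fin d) (Fin r) ℝ}
    (hU : Uᵀ * U = 1) (M : Matrix (Fin r) (Fin n) ℝ) : frobSq (U * M) = frobSq M := by
  have h : ∀ {a b : ℕ} (B : Matrix (Fin a) (Fin b) ℝ), frobSq B = (Bᵀ * B).trace := by
    intro a b B
    rw [frobSq, Finset.sum_comm]
    simp [trace, mul_apply, sq]
  rw [h, h, transpose_mul, Matrix.mul_assoc, ← Matrix.mul_assoc Uᵀ, hU, Matrix.one_mul]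

lemma sub_Wmat_mul {d N r n : ℕ} (U : Matrix (Fin d) (Fin r) ℝ) (V : Matrix (Fin N) (Fin r) ℝ)
    (S : Matrix (Fin r) (Fin r) ℝ) (L : Matrix (Fin r) (Fin n) ℝ)
    (A : Matrix (Fin d) (Fin N) ℝ) :
    U * L - Wmat (U * S * Vᵀ) A * (U * L) =
      U * (L - S * (pinvCoeff U V (U * S * Vᵀ + A) * L)) := by
  rw [Wmat, pinvCoeff, Matrix.mul_sub]
  simp only [Matrix.mul_assoc]

lemma tendsto_lintegral_finsetSum_mul_sub_sq {ρ : Type*} [Fintype ρ] {Ω : ℕ → Type*}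
    [∀ N, MeasurableSpace (Ω N)] {μ : ∀ N, Measure (Ω N)} {f : ρ → ∀ N, Ω N → ℝ}
    (hf : ∀ q N, Measurable (f q N)) {t : ρ → ℝ}
    (h : ∀ q, Tendsto (fun N => ∫⁻ x, ENNReal.ofReal ((f q N x - t q) ^ 2) ∂(μ N)) atTop (nhds 0))
    (b s : ℝ) (w : ρ → ℝ) :
    Tendsto (fun N => ∫⁻ x, ENNReal.ofReal
      (((b - s * ∑ q, f q N x * w q) - (b - s * ∑ q, t q * w q)) ^ 2) ∂(μ N)) atTop (nhds 0) := by
  set C := s ^ 2 * ∑ q, w q ^ 2 with hC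
  have hC0 : 0 ≤ C := by positivity
  have hlim : Tendsto (fun N => ENNReal.ofReal C *
      ∑ q, ∫⁻ x, ENNReal.ofReal ((f q N x - t q) ^ 2) ∂(μ N)) atTop (nhds 0) := by
    have := ENNReal.Tendsto.const_mul (a := ENNReal.ofReal C)
      (tendsto_finsetSum Finset.univ fun q _ => h q) (Or.inr ENNReal.ofReal_ne_top)
    simpa using this
  refine tendsto_of_tendsto_of_tendsto_of_le_of_le tendsto_const_nhds hlim
    (fun _ => zero_le) fun N => ?_
  have hm : ∀ q, Measurable fun x => ENNReal.ofReal ((f q N x - t q) ^ 2) := fun q => by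
    have := hf q N
    fun_prop
  beta_reduce
  rw [← lintegral_finsetSum _ fun q _ => hm q, ← lintegral_const_mul _
    (Finset.measurable_sum _ fun q _ => hm q)]
  refine lintegral_mono fun x => ?_
  beta_reduce
  rw [← ENNReal.ofReal_sum_of_nonneg fun q _ => sq_nonneg _, ← ENNReal.ofReal_mul hC0]
  refine ENNReal.ofReal_le_ofReal ?_
  have e : (b - s * ∑ q, f q N x * w q) - (b - s * ∑ q, t q * w q) =
      -(s * ∑ q, w q * (f q N x - t q)) := by
    have : ∀ q, w q * (f q N x - t q) = f q N x * w q - t q * w q := fun q => by ring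
    simp_rw [this, Finset.sum_sub_distrib]
    ring
  rw [e, neg_sq, mul_pow, hC, mul_assoc]
  gcongr
  exact Finset.sum_mul_sq_le_sq_mul_sq _ _ _

lemma inv_diagonal_sq_add_smul_mul {r n : ℕ} {σ : Fin r → ℝ} {h : ℝ} (hσ : ∀ i, 0 < σ i) (hh : 0 < h)
    (L : Matrix (Fin r) (Fin n) ℝ) (i : Fin r) (j : Fin n) :
    ((diagonal σ ^ 2 + h • (1 : Matrix (Fin r) (Fin r) ℝ))⁻¹ * L) i j =
      (σ i ^ 2 + h)⁻¹ * L i j := by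
  have hpos : ∀ i, 0 < σ i ^ 2 + h := fun i => by have := hσ i; positivity
  have h1 : diagonal σ ^ 2 + h • (1 : Matrix (Fin r) (Fin r) ℝ) =
      diagonal fun i => σ i ^ 2 + h := by
    rw [diagonal_pow, smul_one_eq_diagonal, diagonal_add]
    rfl
  have h2 : (diagonal fun i => σ i ^ 2 + h)⁻¹ = diagonal fun i => (σ i ^ 2 + h)⁻¹ := by
    refine inv_eq_right_inv ?_
    rw [diagonal_mul_diagonal, ← diagonal_one]
    congr 1; ext i
    exact mul_inv_cancel₀ (hpos i).ne'
  rw [h1, h2, diagonal_mul]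

/-- **Lemma (bias term of the test error, `c > 1`).**
Fix `c > 1`, `η_trn > 0`, positive integers `r` and `N_tst`, an invertible diagonal `r × r`
matrix `Σ = S` with positive diagonal entries, and an `r × N_tst` matrix `L`.  For each
`N`, let `d = d(N)` satisfy `d(N)/N → c`, let `A_N` be a `d × N` random matrix with i.i.d.
Gaussian entries of mean `0` and variance `η_trn²/d`, let `U_N` be `d × r` with
`U_Nᵀ U_N = I_r`, `V_N` be `N × r` with `V_Nᵀ V_N = I_r`, `X_N = U_N S V_Nᵀ`,
`X_tst = U_N L`, and `W_N = X_N ((X_N+A_N)ᵀ(X_N+A_N))⁻¹ (X_N+A_N)ᵀ`.  Then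
`E[(1/N_tst) ‖X_tst - W_N X_tst‖_F²] → (η_trn⁴/N_tst) ‖(S² + η_trn² I_r)⁻¹ L‖_F²`. -/
theorem stmt_16 (c ηtrn : ℝ) (hc : 1 < c) (hη : 0 < ηtrn) (r Ntst : ℕ)
    (hr : 0 < r) (hNtst : 0 < Ntst)
    (S : Matrix (Fin r) (Fin r) ℝ) (σ : Fin r → ℝ) (hσ : ∀ i, 0 < σ i)
    (hSdiag : S = Matrix.diagonal σ)
    (L : Matrix (Fin r) (Fin Ntst) ℝ)
    (d : ℕ → ℕ) (hd : ∀ N, 0 < d N)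
    (hdc : Tendsto (fun N : ℕ => (d N : ℝ) / N) atTop (nhds c))
    (U : (N : ℕ) → Matrix (Fin (d N)) (Fin r) ℝ)
    (hU : ∀ N, r ≤ d N → (U N)ᵀ * U N = 1)
    (V : (N : ℕ) → Matrix (Fin N) (Fin r) ℝ)
    (hV : ∀ N, r ≤ N → (V N)ᵀ * V N = 1) :
    Tendsto
      (fun N : ℕ => ∫ A,
          (1 / (Ntst : ℝ)) *
            frobSq (U N * L - Wmat (U N * S * (V N)ᵀ) A * (U N * L))
          ∂(gaussMatrix (d N) N ((ηtrn ^ 2 / (d N : ℝ)).toNNReal)))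
      atTop
      (nhds ((ηtrn ^ 4 / (Ntst : ℝ)) *
        frobSq ((S ^ 2 + (ηtrn ^ 2) • (1 : Matrix (Fin r) (Fin r) ℝ))⁻¹ * L))) := by
  have hh : 0 < ηtrn ^ 2 := by positivity
  have hc0 : 0 < c := by linarith
  set t : Matrix (Fin r) (Fin r) ℝ := diagonal fun i => σ i / (σ i ^ 2 + ηtrn ^ 2) with ht
  set μ : ∀ N, Measure (Matrix (Fin (d N)) (Fin N) ℝ) :=
    fun N => gaussMatrix (d N) N ((ηtrn ^ 2 / (d N : ℝ)).toNNReal) with hμ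
  set T : ∀ N, Matrix (Fin (d N)) (Fin N) ℝ → Matrix (Fin r) (Fin r) ℝ :=
    fun N A => pinvCoeff (U N) (V N) (U N * diagonal σ * (V N)ᵀ + A) with hT
  have hTm : ∀ N p q, Measurable fun A => T N A p q := fun N p q =>
    measurable_pinvCoeff_apply _ p q
  set E : ∀ N, Matrix (Fin (d N)) (Fin N) ℝ → Matrix (Fin r) (Fin Ntst) ℝ :=
    fun N A => L - diagonal σ * (T N A * L) with hE
  have hEapply : ∀ N A i j, E N A i j = L i j - σ i * ∑ q, T N A i q * L q j := fun N A i j => by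
    change (L - diagonal σ * (T N A * L)) i j = _
    rw [Matrix.sub_apply, diagonal_mul, mul_apply]
  have hlim : ∀ i j, (∀ᶠ N in atTop, Integrable (fun A => E N A i j ^ 2) (μ N)) ∧
      Tendsto (fun N => ∫ A, E N A i j ^ 2 ∂(μ N)) atTop
        (nhds ((L i j - σ i * ∑ q, t i q * L q j) ^ 2)) := by
    intro i j
    refine tendsto_integral_sq (fun N => ?_) ?_
    · simp_rw [hEapply]
      exact measurable_const.sub (measurable_const.mul
        (Finset.measurable_sum _ fun q _ => (hTm N i q).mul measurable_const))
    · simp_rw [hEapply]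
      exact tendsto_lintegral_finsetSum_mul_sub_sq (f := fun q N A => T N A i q)
        (fun q N => hTm N i q)
        (fun q => tendsto_lintegral_pinvCoeff_sub_sq hc hη hdc hU hV σ i q)
        (L i j) (σ i) fun q => L q j
  have hmain : Tendsto (fun N => 1 / (Ntst : ℝ) * ∑ i, ∑ j, ∫ A, E N A i j ^ 2 ∂(μ N)) atTop
      (nhds (1 / (Ntst : ℝ) * ∑ i, ∑ j, (L i j - σ i * ∑ q, t i q * L q j) ^ 2)) :=
    (tendsto_finsetSum _ fun i _ => tendsto_finsetSum _ fun j _ => (hlim i j).2).const_mul _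
  have hval : 1 / (Ntst : ℝ) * ∑ i, ∑ j, (L i j - σ i * ∑ q, t i q * L q j) ^ 2 =
      ηtrn ^ 4 / (Ntst : ℝ) *
        frobSq ((S ^ 2 + (ηtrn ^ 2) • (1 : Matrix (Fin r) (Fin r) ℝ))⁻¹ * L) := by
    rw [frobSq, div_eq_mul_one_div (ηtrn ^ 4), mul_comm (ηtrn ^ 4), mul_assoc]
    congr 1
    rw [Finset.mul_sum]
    refine Finset.sum_congr rfl fun i _ => ?_
    rw [Finset.mul_sum]
    refine Finset.sum_congr rfl fun j _ => ?_
    have hpos : 0 < σ i ^ 2 + ηtrn ^ 2 := by positivity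
    rw [hSdiag, inv_diagonal_sq_add_smul_mul hσ hh]
    have : ∑ q, t i q * L q j = σ i / (σ i ^ 2 + ηtrn ^ 2) * L i j := by
      rw [← mul_apply, ht, diagonal_mul]
    rw [this]
    field_simp
    ring
  rw [← hval]
  refine hmain.congr' ?_
  have hint : ∀ᶠ N in atTop, ∀ i j, Integrable (fun A => E N A i j ^ 2) (μ N) := by
    simp only [eventually_all]
    exact fun i j => (hlim i j).1
  filter_upwards [hint,
    (tendsto_natCast_atTop_iff.mp (tendsto_atTop_of_ratio hc0 hdc)).eventually_ge_atTop r]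
    with N hN hrd
  rw [integral_const_mul]
  congr 1
  have : ∀ A, frobSq (U N * L - Wmat (U N * S * (V N)ᵀ) A * (U N * L)) =
      ∑ i, ∑ j, E N A i j ^ 2 := by
    intro A
    rw [sub_Wmat_mul, frobSq_mul_of_transpose_mul_self (hU N hrd), hSdiag]
    rfl
  simp_rw [this]
  rw [integral_finsetSum _ fun i _ => integrable_finsetSum _ fun j _ => hN i j]
  refine Finset.sum_congr rfl fun i _ => ?_
  rw [integral_finsetSum _ fun j _ => hN i j]
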